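/- arXiv:2007.12151 — 4 statements merged into one kernel-verified Lean document; each statement's English description precedes it below -/
import Mathlib

section
/- Let M₁,…,M_n be real skew-symmetric m×m matrices with 2 ≤ n ≤ m, and let v₁,…,v_{m−n} be nonpositive real numbers such that M₁² − Σ_{l=2}^n M_l² = Diag(−(1/2)tr(M₁²), (1/2)tr(M₂²), …, (1/2)tr(M_n²), v₁, …, v_{m−n}). Then v₁ = … = v_{m−n} = 0, the smallest eigenvalue of Σ_{l=2}^n M_l² equals the sum of the smallest eigenvalues of the M_l² (i.e. λ₁(Σ_{l=2}^n M_l²) = Σ_{l=2}^n λ₁(M_l²)), and rank(M_i) ≤ 2 for every i ∈ {2,…,n}. -/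
open Matrix Finset

noncomputable section

/-- The smallest eigenvalue of a real (symmetric) matrix, as the infimum of its spectrum. -/
def minEig {m : ℕ} (A : Matrix (Fin m) (Fin m) ℝ) : ℝ := sInf (spectrum ℝ A)

theorem minEig_eq_of_eigenvector {m : ℕ} {A : Matrix (Fin m) (Fin m) ℝ} {c : ℝ}
    {e : Fin m → ℝ} (he : e ≠ 0) (hAe : A *ᵥ e = c • e)
    (hA : ∀ x : Fin m → ℝ, c * (x ⬝ᵥ x) ≤ x ⬝ᵥ (A *ᵥ x)) : minEig A = c := by
  refine IsLeast.csInf_eq ⟨?_, fun μ hμ => ?_⟩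
  · rw [← Matrix.spectrum_toLin', ← Module.End.hasEigenvalue_iff_mem_spectrum]
    exact Module.End.hasEigenvalue_of_hasEigenvector
      (Module.End.hasEigenvector_iff.2 ⟨Module.End.mem_eigenspace_iff.2 (by simpa using hAe), he⟩)
  · rw [← Matrix.spectrum_toLin', ← Module.End.hasEigenvalue_iff_mem_spectrum] at hμ
    obtain ⟨x, hx⟩ := hμ.exists_hasEigenvector
    have hAx : A *ᵥ x = μ • x := by simpa using hx.apply_eq_smul
    have h := hA x
    rw [hAx, dotProduct_smul, smul_eq_mul] at h
    have hpos : 0 < x ⬝ᵥ x := by simpa using (dotProduct_star_self_pos_iff (v := x)).2 hx.2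
    exact le_of_mul_le_mul_right h hpos

theorem skew_apply {m : ℕ} {M : Matrix (Fin m) (Fin m) ℝ} (hM : Mᵀ = -M) (j k : Fin m) :
    M j k = -M k j := by
  have h := congrFun (congrFun hM k) j
  simpa using h

theorem skew_sq_apply_self {m : ℕ} {M : Matrix (Fin m) (Fin m) ℝ} (hM : Mᵀ = -M) (o : Fin m) :
    (M ^ 2) o o = -∑ j, M j o ^ 2 := by
  rw [sq, Matrix.mul_apply, ← sum_neg_distrib]
  refine sum_congr rfl fun j _ => ?_
  rw [skew_apply hM o j]
  ring

theorem skew_trace_sq {m : ℕ} {M : Matrix (Fin m) (Fin m) ℝ} (hM : Mᵀ = -M) (o : Fin m) :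
    -Matrix.trace (M ^ 2) =
      2 * ∑ j, M j o ^ 2 + ∑ k ∈ univ.erase o, ∑ j ∈ univ.erase o, M j k ^ 2 := by
  have hoo : M o o = 0 := by linarith [skew_apply hM o o]
  have hcol (k : Fin m) : (∑ j, M j k ^ 2) = M k o ^ 2 + ∑ j ∈ univ.erase o, M j k ^ 2 := by
    rw [← add_sum_erase _ _ (mem_univ o), skew_apply hM o k, neg_sq]
  have herase : ∑ k ∈ univ.erase o, M k o ^ 2 = ∑ k, M k o ^ 2 := by
    rw [← add_sum_erase _ (fun k => M k o ^ 2) (mem_univ o), hoo]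
    simp
  simp only [Matrix.trace, Matrix.diag_apply, skew_sq_apply_self hM, sum_neg_distrib, neg_neg]
  rw [← add_sum_erase _ _ (mem_univ o), sum_congr rfl fun k _ => hcol k, sum_add_distrib, herase]
  ring

section Cross

variable {m : ℕ} {M : Matrix (Fin m) (Fin m) ℝ} {o : Fin m}

theorem rank_le_two_of_cross (hM : Mᵀ = -M) (h : ∀ j k, j ≠ o → k ≠ o → M j k = 0) :
    M.rank ≤ 2 := by
  have hoo : M o o = 0 := by linarith [skew_apply hM o o]
  let A : Matrix (Fin m) (Fin 2) ℝ := of fun j => ![M j o, Pi.single (M := fun _ => ℝ) o 1 j]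
  let B : Matrix (Fin 2) (Fin m) ℝ := of ![Pi.single o 1, M o]
  have hdecomp : M = A * B := by
    ext j k
    by_cases hj : j = o <;> by_cases hk : k = o <;>
      simp_all [A, B, mul_apply, Fin.sum_univ_two]
  rw [hdecomp]
  exact (rank_mul_le_left A B).trans (by simpa using A.rank_le_card_width)

theorem sq_mulVec_single_of_cross (hM : Mᵀ = -M) (h : ∀ j k, j ≠ o → k ≠ o → M j k = 0) :
    (M ^ 2) *ᵥ Pi.single o 1 = (-∑ j, M j o ^ 2) • Pi.single o (1 : ℝ) := by
  have hoo : M o o = 0 := by linarith [skew_apply hM o o]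
  ext j
  rw [mulVec_single_one, col_apply]
  by_cases hj : j = o
  · subst hj
    simp [skew_sq_apply_self hM]
  · rw [sq, mul_apply, Pi.smul_apply, Pi.single_eq_of_ne hj, smul_zero]
    refine sum_eq_zero fun k _ => ?_
    by_cases hk : k = o
    · rw [hk, hoo, mul_zero]
    · rw [h j k hj hk, zero_mul]

theorem le_dotProduct_sq_mulVec_of_cross (hM : Mᵀ = -M)
    (h : ∀ j k, j ≠ o → k ≠ o → M j k = 0) (x : Fin m → ℝ) :
    (-∑ j, M j o ^ 2) * (x ⬝ᵥ x) ≤ x ⬝ᵥ ((M ^ 2) *ᵥ x) := by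
  have hoo : M o o = 0 := by linarith [skew_apply hM o o]
  have hquad : x ⬝ᵥ ((M ^ 2) *ᵥ x) = -∑ j, (M *ᵥ x) j ^ 2 := by
    rw [sq, ← mulVec_mulVec, dotProduct_mulVec, ← mulVec_transpose, hM, neg_mulVec,
      neg_dotProduct]
    simp [dotProduct, sq]
  have hrow : (M *ᵥ x) o = -∑ k ∈ univ.erase o, M k o * x k := by
    rw [mulVec, dotProduct, ← add_sum_erase _ _ (mem_univ o), hoo, zero_mul, zero_add,
      ← sum_neg_distrib]
    exact sum_congr rfl fun k _ => by rw [skew_apply hM o k, neg_mul]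
  have hother (j : Fin m) (hj : j ≠ o) : (M *ᵥ x) j = M j o * x o := by
    rw [mulVec, dotProduct]
    exact sum_eq_single o (fun k _ hk => by rw [h j k hj hk, zero_mul]) (by simp)
  have hsum : ∑ j, (M *ᵥ x) j ^ 2 = (∑ k ∈ univ.erase o, M k o * x k) ^ 2
      + (∑ k ∈ univ.erase o, M k o ^ 2) * x o ^ 2 := by
    rw [← add_sum_erase _ _ (mem_univ o), hrow, neg_sq, sum_mul]
    congr 1
    exact sum_congr rfl fun j hj => by rw [hother j (ne_of_mem_erase hj), mul_pow]
  have hcol : ∑ j, M j o ^ 2 = ∑ j ∈ univ.erase o, M j o ^ 2 := by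
    rw [← add_sum_erase _ (fun j => M j o ^ 2) (mem_univ o), hoo]
    simp
  have hx : x ⬝ᵥ x = x o ^ 2 + ∑ k ∈ univ.erase o, x k ^ 2 := by
    rw [dotProduct, ← add_sum_erase _ _ (mem_univ o)]
    simp only [sq]
  have hcs := sum_mul_sq_le_sq_mul_sq (univ.erase o) (fun k => M k o) x
  rw [hquad, hsum, hcol, hx]
  linarith

end Cross

theorem sum_eq_sum_castLE_add {n m : ℕ} (hnm : n ≤ m) (d : Fin m → ℝ) :
    ∑ j, d j = ∑ l, d (Fin.castLE hnm l) +
      ∑ j ∈ univ.filter (fun j : Fin m => n ≤ (j : ℕ)), d j := by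
  obtain ⟨k, rfl⟩ := Nat.exists_eq_add_of_le hnm
  rw [sum_filter, Fin.sum_univ_add,
    Fin.sum_univ_add (fun j : Fin (n + k) => if n ≤ (j : ℕ) then d j else 0)]
  simp [Fin.castLE, Fin.castAdd]
  exact sum_eq_zero fun x _ => if_neg (by omega)

/-- Let `M₁,…,M_n` (here `M 0, …, M (n-1)`) be real skew-symmetric `m×m`
matrices with `2 ≤ n ≤ m`, and suppose
`M₁² − Σ_{l≥2} M_l² = Diag(−½tr M₁², ½tr M₂², …, ½tr M_n², v₁,…,v_{m−n})` with all
`v_i ≤ 0`.  Then all `v_i = 0`, `λ₁(Σ_{l≥2} M_l²) = Σ_{l≥2} λ₁(M_l²)`, and `rank M_i ≤ 2`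
for every `i ≥ 2`. -/
theorem statement10
    {n m : ℕ} (hn : 2 ≤ n) (hnm : n ≤ m)
    (M : Fin n → Matrix (Fin m) (Fin m) ℝ)
    (hskew : ∀ i, (M i)ᵀ = - M i)
    (d : Fin m → ℝ)
    -- the first diagonal entry is `−½ tr(M₁²)`
    (hd1 : d (Fin.castLE hnm ⟨0, by omega⟩) = -(1/2) * Matrix.trace (M ⟨0, by omega⟩ ^ 2))
    -- the next `n−1` diagonal entries are `½ tr(M_l²)`, `l = 2,…,n`
    (hdl : ∀ l : Fin n, (l : ℕ) ≠ 0 → d (Fin.castLE hnm l) = (1/2) * Matrix.trace (M l ^ 2))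
    -- the remaining `m−n` diagonal entries `v₁,…,v_{m−n}` are nonpositive
    (hdv : ∀ j : Fin m, n ≤ (j : ℕ) → d j ≤ 0)
    -- the matrix equation
    (heq : M ⟨0, by omega⟩ ^ 2 - ∑ l ∈ univ.filter (fun l : Fin n => (l : ℕ) ≠ 0), M l ^ 2 = Matrix.diagonal d) :
    -- all `vᵢ` vanish
    (∀ j : Fin m, n ≤ (j : ℕ) → d j = 0) ∧
    -- `λ₁(Σ_{l≥2} M_l²) = Σ_{l≥2} λ₁(M_l²)`
    minEig (∑ l ∈ univ.filter (fun l : Fin n => (l : ℕ) ≠ 0), M l ^ 2)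
      = ∑ l ∈ univ.filter (fun l : Fin n => (l : ℕ) ≠ 0), minEig (M l ^ 2) ∧
    -- `rank M_i ≤ 2` for `i = 2,…,n`
    (∀ i : Fin n, (i : ℕ) ≠ 0 → (M i).rank ≤ 2) := by
  set o : Fin m := Fin.castLE hnm ⟨0, by omega⟩
  set z : Fin n := ⟨0, by omega⟩
  set S := univ.filter (fun l : Fin n => (l : ℕ) ≠ 0)
  set V := univ.filter (fun j : Fin m => n ≤ (j : ℕ))
  let q (l : Fin n) : ℝ := ∑ j, M l j o ^ 2
  let r (l : Fin n) : ℝ := ∑ k ∈ univ.erase o, ∑ j ∈ univ.erase o, M l j k ^ 2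
  have hr (l : Fin n) : 0 ≤ r l := sum_nonneg fun _ _ => sum_nonneg fun _ _ => sq_nonneg _
  have hq : 0 ≤ q z := sum_nonneg fun _ _ => sq_nonneg _
  have htr (l : Fin n) : Matrix.trace (M l ^ 2) = -(2 * q l + r l) := by
    rw [← skew_trace_sq (hskew l) o, neg_neg]
  have hS : S = univ.erase z := by
    ext l
    simp [S, z, Fin.ext_iff]
  have hV : ∑ j ∈ V, d j ≤ 0 := sum_nonpos fun j hj => hdv j (by simpa [V] using hj)
  have hentry : -q z + ∑ l ∈ S, q l = q z + r z / 2 := by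
    have h := congrFun (congrFun heq o) o
    rw [Matrix.sub_apply, Matrix.sum_apply, diagonal_apply_eq, hd1, htr,
      skew_sq_apply_self (hskew z), sum_congr rfl fun l _ => skew_sq_apply_self (hskew l) o,
      sum_neg_distrib] at h
    simp only [q] at h ⊢
    linarith
  have hdS : ∑ l ∈ S, d (Fin.castLE hnm l) = -(∑ l ∈ S, q l) - (∑ l ∈ S, r l) / 2 := by
    rw [sum_div, ← sum_neg_distrib, ← sum_sub_distrib]
    refine sum_congr rfl fun l hl => ?_
    rw [hdl l (by simpa [S] using hl), htr]
    ring
  have htrace : 3 * (∑ l ∈ S, (2 * q l + r l)) - 3 * (2 * q z + r z) = 2 * ∑ j ∈ V, d j := by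
    have h := congrArg Matrix.trace heq
    have hd := sum_eq_sum_castLE_add hnm d
    rw [← add_sum_erase _ _ (mem_univ z), ← hS, hdS, show d (Fin.castLE hnm z) = _ from hd1,
      htr] at hd
    rw [trace_sub, trace_sum, trace_diagonal, hd, htr, sum_congr rfl fun l _ => htr l,
      sum_neg_distrib] at h
    rw [sum_add_distrib, ← mul_sum] at h ⊢
    linarith
  have hrS : 0 ≤ ∑ l ∈ S, r l := sum_nonneg fun l _ => hr l
  rw [sum_add_distrib, ← mul_sum] at htrace
  have hV0 : ∑ j ∈ V, d j = 0 := by linarith [hr z]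
  have hrS0 : ∑ l ∈ S, r l = 0 := by linarith [hr z]
  have hcross (l : Fin n) (hl : l ∈ S) (j k : Fin m) (hj : j ≠ o) (hk : k ≠ o) :
      M l j k = 0 := by
    have h := (sum_eq_zero_iff_of_nonneg fun l _ => hr l).1 hrS0 l hl
    have h' := (sum_eq_zero_iff_of_nonneg fun _ _ => sum_nonneg fun _ _ => sq_nonneg _).1 h k
      (mem_erase.2 ⟨hk, mem_univ k⟩)
    exact pow_eq_zero_iff two_ne_zero |>.1 <|
      (sum_eq_zero_iff_of_nonneg fun _ _ => sq_nonneg _).1 h' j (mem_erase.2 ⟨hj, mem_univ j⟩)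
  have he : (Pi.single o 1 : Fin m → ℝ) ≠ 0 := by simp
  refine ⟨fun j hj => ?_, ?_, fun i hi => ?_⟩
  · exact (sum_eq_zero_iff_of_nonpos fun j hj => hdv j (by simpa [V] using hj)).1 hV0 j
      (by simpa [V] using hj)
  · rw [sum_congr rfl fun l hl => minEig_eq_of_eigenvector he
      (sq_mulVec_single_of_cross (hskew l) (hcross l hl))
      (le_dotProduct_sq_mulVec_of_cross (hskew l) (hcross l hl))]
    refine minEig_eq_of_eigenvector he ?_ fun x => ?_
    · rw [sum_mulVec, sum_smul]
      exact sum_congr rfl fun l hl => sq_mulVec_single_of_cross (hskew l) (hcross l hl)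
    · rw [sum_mulVec, dotProduct_sum, sum_mul]
      exact sum_le_sum fun l hl =>
        le_dotProduct_sq_mulVec_of_cross (hskew l) (hcross l hl) x
  · exact rank_le_two_of_cross (hskew i) (hcross i (by simpa [S] using hi))
end
end

section
/- Let V be an m-dimensional Euclidean vector space (finite-dimensional real inner product space) and let K₁,…,K_n : V → V be skew-symmetric endomorphisms with n < m. Assume that rank(K_i) = 2 for all i, that tr(K_i ∘ K_j) = 0 for all i ≠ j, and that λ₁(K) = Σ_{i=1}^n λ₁(K_i²), where K := Σ_{i=1}^n K_i² and λ₁ denotes the smallest eigenvalue of a symmetric endomorphism. Then there exist an orthonormal family {u₀, u₁, …, u_n, v₁, …, v_{m−n−1}} forming a basis of V and nonzero real numbers α₁,…,α_n such that for all 1 ≤ i, j ≤ n and 1 ≤ l ≤ m−n−1: K_i(u₀) = α_i u_i, K_i(u_j) = −δ_{ij} α_i u₀, and K_i(v_l) = 0. -/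
open Module RealInnerProductSpace

noncomputable section

/-- The Rayleigh quotient of a symmetric endomorphism is at least its smallest eigenvalue, and
vectors realizing equality are eigenvectors. -/
theorem LinearMap.IsSymmetric.sInf_spectrum_mul_le {V : Type*} [NormedAddCommGroup V]
    [InnerProductSpace ℝ V] [FiniteDimensional ℝ V] {T : Module.End ℝ V}
    (hT : LinearMap.IsSymmetric T) (x : V) :
    sInf (spectrum ℝ T) * ⟪x, x⟫ ≤ ⟪T x, x⟫ ∧
      (⟪T x, x⟫ = sInf (spectrum ℝ T) * ⟪x, x⟫ → T x = sInf (spectrum ℝ T) • x) := by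
  set c := sInf (spectrum ℝ T)
  set b := hT.eigenvectorBasis rfl
  set e := hT.eigenvalues rfl
  have hTb : ∀ i, T (b i) = e i • b i := fun i => hT.apply_eigenvectorBasis rfl i
  have hc : ∀ i, c ≤ e i := fun i =>
    csInf_le (Module.End.finite_spectrum T).bddBelow
      (Module.End.hasEigenvalue_iff_mem_spectrum.1 (hT.hasEigenvalue_eigenvalues rfl i))
  have hbT : ∀ i, ⟪b i, T x⟫ = e i * ⟪b i, x⟫ := fun i => by
    rw [← hT (b i) x, hTb, real_inner_smul_left]
  have hsum : ⟪T x, x⟫ - c * ⟪x, x⟫ = ∑ i, (e i - c) * ⟪b i, x⟫ ^ 2 := by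
    rw [← b.sum_inner_mul_inner (T x) x, ← b.sum_inner_mul_inner x x, Finset.mul_sum,
      ← Finset.sum_sub_distrib]
    refine Finset.sum_congr rfl fun i _ => ?_
    rw [real_inner_comm, hbT, real_inner_comm (b i) x]
    ring
  have hnn : ∀ i ∈ Finset.univ, 0 ≤ (e i - c) * ⟪b i, x⟫ ^ 2 := fun i _ =>
    mul_nonneg (sub_nonneg.2 (hc i)) (sq_nonneg _)
  refine ⟨by linarith [Finset.sum_nonneg hnn], fun h => ?_⟩
  rw [h, sub_self, eq_comm, Finset.sum_eq_zero_iff_of_nonneg hnn] at hsum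
  refine InnerProductSpace.ext_inner_left_basis b.toBasis fun i => ?_
  rw [OrthonormalBasis.coe_toBasis, hbT, real_inner_smul_right]
  rcases mul_eq_zero.1 (hsum i (Finset.mem_univ i)) with h0 | h0
  · rw [sub_eq_zero.1 h0]
  · rw [pow_eq_zero_iff two_ne_zero] at h0
    simp [h0]

/-- The smallest eigenvalue of a symmetric endomorphism has a unit eigenvector. -/
theorem LinearMap.IsSymmetric.exists_unit_eigenvector_sInf_spectrum {V : Type*}
    [NormedAddCommGroup V] [InnerProductSpace ℝ V] [FiniteDimensional ℝ V] [Nontrivial V]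
    {T : Module.End ℝ V} (hT : LinearMap.IsSymmetric T) :
    ∃ x : V, ‖x‖ = 1 ∧ T x = sInf (spectrum ℝ T) • x := by
  have hne : (spectrum ℝ T).Nonempty :=
    ⟨_, Module.End.hasEigenvalue_iff_mem_spectrum.1
      (hT.hasEigenvalue_eigenvalues rfl ⟨0, Module.finrank_pos⟩)⟩
  obtain ⟨v, hv⟩ := (Module.End.hasEigenvalue_iff_mem_spectrum.2
    (hne.csInf_mem (Module.End.finite_spectrum T))).exists_hasEigenvector
  refine ⟨‖v‖⁻¹ • v, norm_smul_inv_norm hv.2, ?_⟩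
  rw [map_smul, hv.apply_eq_smul, smul_comm]

/-- A skew-symmetric endomorphism of rank two whose square has the unit vector `u` as an
eigenvector outside the kernel is `x ↦ ⟪u, x⟫ T u - ⟪T u, x⟫ u`. -/
theorem skew_apply_eq_of_finrank_range_eq_two {V : Type*} [NormedAddCommGroup V]
    [InnerProductSpace ℝ V] [FiniteDimensional ℝ V] {T : Module.End ℝ V}
    (hT : ∀ x y : V, ⟪T x, y⟫ = -⟪x, T y⟫) (hrank : Module.finrank ℝ (LinearMap.range T) = 2)
    {u : V} (hu : ‖u‖ = 1) (hTu : T u ≠ 0) {c : ℝ} (hc : T (T u) = c • u) (x : V) :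
    T x = ⟪u, x⟫ • T u - ⟪T u, x⟫ • u := by
  have huu : ⟪u, u⟫ = 1 := by rw [real_inner_self_eq_norm_sq, hu, one_pow]
  have hww : ⟪T u, T u⟫ = -c := by rw [hT, hc, real_inner_smul_right, huu, mul_one]
  have huw : ⟪u, T u⟫ = 0 := by
    have := hT u u
    rw [real_inner_comm] at this
    linarith
  have hc0 : c ≠ 0 := fun h => hTu (inner_self_eq_zero (𝕜 := ℝ).1 (by rw [hww, h, neg_zero]))
  have hli : LinearIndependent ℝ ![u, T u] := by
    refine LinearIndependent.pair_iff.2 fun s t h => ?_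
    have h1 : ⟪u, s • u + t • T u⟫ = 0 := by rw [h, inner_zero_right]
    have h2 : ⟪T u, s • u + t • T u⟫ = 0 := by rw [h, inner_zero_right]
    rw [inner_add_right, real_inner_smul_right, real_inner_smul_right] at h1 h2
    rw [huu, huw] at h1
    rw [real_inner_comm, huw, hww] at h2
    exact ⟨by linarith, by simpa [hc0] using h2⟩
  have hspan : Submodule.span ℝ (Set.range ![u, T u]) = LinearMap.range T := by
    refine Submodule.eq_of_le_of_finrank_eq ?_ ?_
    · rw [Submodule.span_le]
      rintro _ ⟨i, rfl⟩
      fin_cases i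
      · exact ⟨c⁻¹ • T u, by simp [hc, hc0]⟩
      · exact ⟨u, rfl⟩
    · rw [finrank_span_eq_card hli, hrank, Fintype.card_fin]
  obtain ⟨p, q, hpq⟩ : ∃ p q : ℝ, p • u + q • T u = T x := by
    have : T x ∈ Submodule.span ℝ (Set.range ![u, T u]) := hspan ▸ LinearMap.mem_range_self T x
    rwa [Matrix.range_cons, Matrix.range_cons, Matrix.range_empty, Set.union_empty,
      Set.singleton_union, Submodule.mem_span_pair] at this
  have h1 : p = -⟪T u, x⟫ := by
    rw [hT, ← hpq, inner_add_right, real_inner_smul_right, real_inner_smul_right, huu, huw]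
    ring
  have h2 : q = ⟪u, x⟫ := by
    have h3 : ⟪T u, T x⟫ = -(c * ⟪u, x⟫) := by
      have := hT (T u) x
      rw [hc, real_inner_smul_left] at this
      linarith
    rw [← hpq, inner_add_right, real_inner_smul_right, real_inner_smul_right, hww,
      real_inner_comm, huw] at h3
    apply mul_right_cancel₀ hc0
    linarith
  rw [← hpq, h1, h2, neg_smul]
  abel

/-- An orthonormal family indexed by `Fin k` can be completed to an orthonormal family whose
cardinality is the dimension. -/
theorem Orthonormal.exists_orthonormal_sumElim {V : Type*} [NormedAddCommGroup V]
    [InnerProductSpace ℝ V] [FiniteDimensional ℝ V] {k l : ℕ} {u : Fin k → V}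
    (hu : Orthonormal ℝ u) (hkl : k + l = Module.finrank ℝ V) :
    ∃ w : Fin l → V, Orthonormal ℝ (Sum.elim u w) := by
  set S := Submodule.span ℝ (Set.range u)
  have hS : Module.finrank ℝ Sᗮ = l := by
    have h1 := S.finrank_add_finrank_orthogonal
    have h2 : Module.finrank ℝ S = k := by
      rw [finrank_span_eq_card hu.linearIndependent, Fintype.card_fin]
    omega
  set b := (stdOrthonormalBasis ℝ Sᗮ).reindex (finCongr hS)
  have huw : ∀ i j, ⟪u i, (b j : V)⟫ = 0 := fun i j =>
    Submodule.inner_right_of_mem_orthogonal (Submodule.subset_span (Set.mem_range_self i)) (b j).2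
  have hb := orthonormal_iff_ite.1 b.orthonormal
  refine ⟨fun j => b j, orthonormal_iff_ite.2 ?_⟩
  rintro (i | i) (j | j)
  · simpa using orthonormal_iff_ite.1 hu i j
  · simpa using huw i j
  · simpa [real_inner_comm] using huw j i
  · simpa using hb i j

/-- Let `V` be an `m`-dimensional Euclidean vector space and `K₁,…,K_n`
skew-symmetric endomorphisms of `V` with `n < m`, such that `rank Kᵢ = 2`, `tr(Kᵢ∘Kⱼ) = 0`
for `i ≠ j`, and `λ₁(Σ Kᵢ²) = Σ λ₁(Kᵢ²)`.  Then there are an orthonormal basis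
`{u₀,…,u_n, v₁,…,v_{m−n−1}}` of `V` and nonzero reals `α₁,…,α_n` with
`Kᵢ(u₀) = αᵢ uᵢ`, `Kᵢ(uⱼ) = −δᵢⱼ αᵢ u₀` and `Kᵢ(v_l) = 0`. -/
theorem statement11
    {V : Type*} [NormedAddCommGroup V] [InnerProductSpace ℝ V] [FiniteDimensional ℝ V]
    {n : ℕ} (hn : n < Module.finrank ℝ V)
    (K : Fin n → Module.End ℝ V)
    (hskew : ∀ i, ∀ u v : V, ⟪K i u, v⟫ = - ⟪u, K i v⟫)
    (hrank : ∀ i, Module.finrank ℝ (LinearMap.range (K i)) = 2)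
    (htr : ∀ i j, i ≠ j → LinearMap.trace ℝ V (K i ∘ₗ K j) = 0)
    -- `λ₁(K) = Σᵢ λ₁(Kᵢ²)` with `K = Σᵢ Kᵢ²`, `λ₁` the smallest eigenvalue
    (heig : sInf (spectrum ℝ (∑ i, K i ∘ₗ K i))
      = ∑ i, sInf (spectrum ℝ (K i ∘ₗ K i))) :
    ∃ (u : Fin (n + 1) → V) (w : Fin (Module.finrank ℝ V - n - 1) → V) (α : Fin n → ℝ),
      -- `{u₀,…,u_n, v₁,…,v_{m−n−1}}` is an orthonormal family forming a basis of `V`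
      Orthonormal ℝ (Sum.elim u w) ∧
      Submodule.span ℝ (Set.range (Sum.elim u w)) = ⊤ ∧
      (∀ i, α i ≠ 0) ∧
      (∀ i : Fin n, K i (u 0) = α i • u i.succ) ∧
      (∀ i j : Fin n, K i (u j.succ) = if i = j then (- α i) • u 0 else 0) ∧
      (∀ i l, K i (w l) = 0) := by
  have : Nontrivial V := Module.nontrivial_of_finrank_pos (R := ℝ) (by omega)
  have hsym : ∀ i, LinearMap.IsSymmetric (K i ∘ₗ K i) := fun i x y => by
    rw [LinearMap.comp_apply, LinearMap.comp_apply, hskew, hskew, neg_neg]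
  have hsymsum : LinearMap.IsSymmetric (∑ i, K i ∘ₗ K i) := fun x y => by
    simp only [LinearMap.sum_apply, sum_inner, inner_sum, hsym _ x y]
  obtain ⟨u, hu, hKu⟩ := hsymsum.exists_unit_eigenvector_sInf_spectrum
  have huu : ⟪u, u⟫ = 1 := by rw [real_inner_self_eq_norm_sq, hu, one_pow]
  have hRayleigh : ∀ i, ⟪(K i ∘ₗ K i) u, u⟫ = sInf (spectrum ℝ (K i ∘ₗ K i)) * ⟪u, u⟫ := by
    have hle : ∀ i ∈ Finset.univ,
        sInf (spectrum ℝ (K i ∘ₗ K i)) * ⟪u, u⟫ ≤ ⟪(K i ∘ₗ K i) u, u⟫ := fun i _ =>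
      ((hsym i).sInf_spectrum_mul_le u).1
    have hsum : ∑ i, sInf (spectrum ℝ (K i ∘ₗ K i)) * ⟪u, u⟫ = ∑ i, ⟪(K i ∘ₗ K i) u, u⟫ := by
      rw [← Finset.sum_mul, ← heig, ← real_inner_smul_left, ← hKu, LinearMap.sum_apply, sum_inner]
    exact fun i => ((Finset.sum_eq_sum_iff_of_le hle).1 hsum i (Finset.mem_univ i)).symm
  have hsq : ∀ i, K i (K i u) = sInf (spectrum ℝ (K i ∘ₗ K i)) • u := fun i =>
    ((hsym i).sInf_spectrum_mul_le u).2 (hRayleigh i)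
  have hne : ∀ i, K i u ≠ 0 := fun i h0 => by
    have hzero : K i = 0 := by
      ext x
      have hx := ((hsym i).sInf_spectrum_mul_le x).1
      have hc := hRayleigh i
      rw [LinearMap.comp_apply, h0, map_zero, inner_zero_left, huu, mul_one] at hc
      rw [← hc, zero_mul, LinearMap.comp_apply, hskew] at hx
      exact real_inner_self_nonpos.1 (by simpa using hx)
    have := hrank i
    rw [hzero, LinearMap.range_zero, finrank_bot] at this
    omega
  have hform : ∀ i x, K i x = ⟪u, x⟫ • K i u - ⟪K i u, x⟫ • u := fun i =>
    skew_apply_eq_of_finrank_range_eq_two (hskew i) (hrank i) hu (hne i) (hsq i)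
  have huK : ∀ i, ⟪u, K i u⟫ = 0 := fun i => by
    have := hskew i u u
    rw [real_inner_comm] at this
    linarith
  have horth : ∀ i j, i ≠ j → ⟪K i u, K j u⟫ = 0 := fun i j hij => by
    have hcomp : K i ∘ₗ K j = (innerₛₗ ℝ u).smulRight (K i (K j u))
        - (innerₛₗ ℝ (K j u)).smulRight (K i u) := by
      ext x
      simp [hform j x]
    have h := htr i j hij
    rw [hcomp, map_sub, LinearMap.trace_smulRight, LinearMap.trace_smulRight, innerₛₗ_apply_apply,
      innerₛₗ_apply_apply] at h
    have h1 := hskew i u (K j u)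
    have h2 := real_inner_comm (K i u) (K j u)
    linarith
  set α : Fin n → ℝ := fun i => ‖K i u‖
  have hα : ∀ i, α i ≠ 0 := fun i => norm_ne_zero_iff.2 (hne i)
  set U : Fin (n + 1) → V := Fin.cons u fun i => (α i)⁻¹ • K i u
  have hU0 : U 0 = u := rfl
  have hUs : ∀ i : Fin n, U i.succ = (α i)⁻¹ • K i u := fun i => rfl
  have hKU : ∀ i, K i u = α i • U i.succ := fun i => by rw [hUs, smul_inv_smul₀ (hα i)]
  have hU : Orthonormal ℝ U := by
    refine ⟨fun i => ?_, fun i j hij => ?_⟩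
    · refine Fin.cases hu (fun i => ?_) i
      exact norm_smul_inv_norm (hne i)
    · rcases Fin.eq_zero_or_eq_succ i with rfl | ⟨i, rfl⟩ <;>
        rcases Fin.eq_zero_or_eq_succ j with rfl | ⟨j, rfl⟩
      · exact absurd rfl hij
      · rw [hU0, hUs, real_inner_smul_right, huK, mul_zero]
      · rw [hU0, hUs, real_inner_smul_left, real_inner_comm, huK, mul_zero]
      · rw [hUs, hUs, real_inner_smul_left, real_inner_smul_right,
          horth i j fun h => hij (by rw [h]), mul_zero, mul_zero]
  obtain ⟨w, hw⟩ := hU.exists_orthonormal_sumElim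
    (show n + 1 + (Module.finrank ℝ V - n - 1) = Module.finrank ℝ V by omega)
  have hUw : ∀ i l, ⟪U i, w l⟫ = 0 := fun i l => hw.2 (i := Sum.inl i) (j := Sum.inr l) (by simp)
  refine ⟨U, w, α, hw, hw.linearIndependent.span_eq_top_of_card_eq_finrank' ?_, hα, hKU,
    fun i j => ?_, fun i l => ?_⟩
  · simp only [Fintype.card_sum, Fintype.card_fin]
    omega
  · rw [hform i, hKU i, real_inner_smul_left, orthonormal_iff_ite.1 hU, ← hU0,
      orthonormal_iff_ite.1 hU, if_neg (Fin.succ_ne_zero j).symm, zero_smul, zero_sub]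
    by_cases h : i = j <;> simp [h]
  · rw [hform i, hKU i, real_inner_smul_left, hUw, ← hU0, hUw]
    simp
end
end

section
/- Let k ≥ 1 and consider the system of matrix equations on ℝ^{2k}: K² = P⁻¹AP + A and αK = AP − P⁻¹A, where K is an invertible real skew-symmetric 2k×2k matrix, P is an orthogonal 2k×2k matrix, A = Diag(−α₁², …, −α_{2k}²) with all α_i ≠ 0, and α = ±√(α₁² + ⋯ + α_{2k}²). If (K, P, A) solves this system, then k = 1, and there exists ε ∈ {−1, +1} such that K = ε√(α₁²+α₂²)·[[0,1],[−1,0]] and P = sgn(α)·ε·[[0,−1],[1,0]], with A = Diag(−α₁², −α₂²). -/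
open Matrix

noncomputable section

section TraceArgument

variable {n : Type*} [Fintype n] [DecidableEq n]

theorem trace_mul_mul_mul_of_system {K P A : Matrix n n ℝ} {a : ℝ}
    (hA : Aᵀ = A) (hP : Pᵀ * P = 1) (ha : a ^ 2 = -A.trace)
    (heq1 : K ^ 2 = Pᵀ * A * P + A) (heq2 : a • K = A * P - Pᵀ * A) :
    (A * P * (A * P)).trace = (A * A).trace - A.trace ^ 2 := by
  have hP' : P * Pᵀ = 1 := mul_eq_one_comm.mp hP
  have hK : (K ^ 2).trace = 2 * A.trace := by
    rw [heq1, trace_add, trace_mul_cycle, hP', one_mul, two_mul]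
  have hsq : a ^ 2 • K ^ 2 = A * P * (A * P) - A * A - Pᵀ * (A * A) * P
      + Pᵀ * A * (Pᵀ * A) := by
    rw [← smul_pow, heq2, sq, mul_sub, sub_mul, sub_mul, mul_assoc A P (Pᵀ * A),
      ← mul_assoc P Pᵀ A, hP', one_mul]
    simp only [mul_assoc]
    abel
  have hT : (Pᵀ * A * (Pᵀ * A)).trace = (A * P * (A * P)).trace := by
    rw [← trace_transpose]
    simp [transpose_mul, hA]
  have hC : (Pᵀ * (A * A) * P).trace = (A * A).trace := by
    rw [trace_mul_cycle, hP', one_mul]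
  have h := congrArg trace hsq
  rw [trace_smul, trace_add, trace_sub, trace_sub, hT, hC, hK, ha, smul_eq_mul] at h
  linarith

theorem sum_sq_row_of_orthogonal {P : Matrix n n ℝ} (hP : Pᵀ * P = 1) (i : n) :
    ∑ j, P i j ^ 2 = 1 := by
  have h := congrFun (congrFun (mul_eq_one_comm.mp hP : P * Pᵀ = 1) i) i
  simpa [mul_apply, sq] using h

theorem sq_entry_le_one_of_orthogonal {P : Matrix n n ℝ} (hP : Pᵀ * P = 1) (i j : n) :
    P i j ^ 2 ≤ 1 := by
  rw [← sum_sq_row_of_orthogonal hP i]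
  exact Finset.single_le_sum (f := fun j => P i j ^ 2) (fun _ _ => sq_nonneg _)
    (Finset.mem_univ j)

theorem entry_mul_entry_of_trace_eq {P : Matrix n n ℝ} {d : n → ℝ} (hd : ∀ i, 0 < d i)
    (hP : Pᵀ * P = 1)
    (h : (diagonal d * P * (diagonal d * P)).trace
      = (diagonal d * diagonal d).trace - (diagonal d).trace ^ 2) (i j : n) :
    P i j * P j i = if i = j then 0 else -1 := by
  have hle (i j : n) : 0 ≤ P i j * P j i + if i = j then 0 else 1 := by
    split_ifs with hij
    · subst hij; simpa using mul_self_nonneg (P i i)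
    · nlinarith [sq_nonneg (P i j + P j i), sq_entry_le_one_of_orthogonal hP i j,
        sq_entry_le_one_of_orthogonal hP j i]
  have hnn (i j : n) : 0 ≤ d i * d j * (P i j * P j i + if i = j then 0 else 1) :=
    mul_nonneg (mul_pos (hd i) (hd j)).le (hle i j)
  have hsum : ∑ i, ∑ j, d i * d j * (P i j * P j i + if i = j then 0 else 1) = 0 := by
    have hterm (i j : n) : d i * d j * (P i j * P j i + if i = j then 0 else 1)
        = d i * P i j * (d j * P j i) + d i * d j - if i = j then d i * d j else 0 := by
      split_ifs <;> ring
    have h1 : (diagonal d * P * (diagonal d * P)).trace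
        = ∑ i, ∑ j, d i * P i j * (d j * P j i) := by
      simp only [trace, diag_apply, mul_apply (M := diagonal d * P), diagonal_mul]
    have h2 : (diagonal d).trace ^ 2 = ∑ i, ∑ j, d i * d j := by
      rw [trace_diagonal, sq, Finset.sum_mul_sum]
    have h3 : (diagonal d * diagonal d).trace = ∑ i, d i * d i := by
      rw [diagonal_mul_diagonal, trace_diagonal]
    simp only [hterm, Finset.sum_sub_distrib, Finset.sum_add_distrib, Finset.sum_ite_eq,
      Finset.mem_univ, if_true]
    rw [← h1, ← h2, ← h3]
    linarith
  have h0 := (Finset.sum_eq_zero_iff_of_nonneg fun i _ =>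
    Finset.sum_nonneg fun j _ => hnn i j).mp hsum i (Finset.mem_univ i)
  have h1 := (Finset.sum_eq_zero_iff_of_nonneg fun j _ => hnn i j).mp h0 j (Finset.mem_univ j)
  have h2 := (mul_eq_zero.mp h1).resolve_left (mul_pos (hd i) (hd j)).ne'
  split_ifs at h2 ⊢ <;> linarith

end TraceArgument

/-- Consider on `ℝ^{2k}` the system `K² = P⁻¹AP + A`,
`αK = AP − P⁻¹A`, with `K` invertible skew-symmetric, `P` orthogonal,
`A = Diag(−α₁²,…,−α_{2k}²)` with all `αᵢ ≠ 0` and `α = ±√(α₁²+⋯+α_{2k}²)`.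
If `(K,P,A)` solves the system then `k = 1` and, for some `ε = ±1`,
`K = ε√(α₁²+α₂²)·[[0,1],[−1,0]]` and `P = sgn(α)·ε·[[0,−1],[1,0]]`. -/
theorem statement12
    {k : ℕ} (hk : 1 ≤ k)
    (K P A : Matrix (Fin (2 * k)) (Fin (2 * k)) ℝ)
    (α : Fin (2 * k) → ℝ) (hα : ∀ i, α i ≠ 0)
    (hA : A = Matrix.diagonal (fun i => - α i ^ 2))
    (hKskew : Kᵀ = - K) (hKinv : IsUnit K)
    (hP : Pᵀ * P = 1)
    (a : ℝ) (ha : a ^ 2 = ∑ i, α i ^ 2)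
    (heq1 : K ^ 2 = Pᵀ * A * P + A)
    (heq2 : a • K = A * P - Pᵀ * A) :
    k = 1 ∧ ∃ ε : ℝ, (ε = 1 ∨ ε = -1) ∧
      (∀ i j : Fin (2 * k), K i j =
        if (i : ℕ) = 0 ∧ (j : ℕ) = 1 then ε * Real.sqrt (∑ l, α l ^ 2)
        else if (i : ℕ) = 1 ∧ (j : ℕ) = 0 then - (ε * Real.sqrt (∑ l, α l ^ 2))
        else 0) ∧
      (∀ i j : Fin (2 * k), P i j =
        if (i : ℕ) = 0 ∧ (j : ℕ) = 1 then - (Real.sign a * ε)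
        else if (i : ℕ) = 1 ∧ (j : ℕ) = 0 then Real.sign a * ε
        else 0) := by
  have hd : ∀ i, 0 < α i ^ 2 := fun i => by have := hα i; positivity
  have hA' : A = -diagonal fun i => α i ^ 2 := by rw [hA, diagonal_neg]
  have hprod := entry_mul_entry_of_trace_eq hd hP <| by
    have h := trace_mul_mul_mul_of_system (a := a) (by rw [hA, diagonal_transpose]) hP
      (by rw [hA', trace_neg, trace_diagonal, neg_neg, ha]) heq1 heq2
    simpa only [hA', trace_neg, neg_mul, mul_neg, neg_neg, neg_sq] using h
  have hsq {i j} (hij : i ≠ j) : P i j ^ 2 = 1 := by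
    have h := hprod i j
    rw [if_neg hij] at h
    nlinarith [sq_nonneg (P i j + P j i), sq_nonneg (P i j - P j i),
      sq_entry_le_one_of_orthogonal hP i j, sq_entry_le_one_of_orthogonal hP j i]
  have hentry (i j : Fin (2 * k)) : a * K i j = -α i ^ 2 * P i j + P j i * α j ^ 2 := by
    have h := congrFun (congrFun heq2 i) j
    simp only [Matrix.smul_apply, Matrix.sub_apply, hA, diagonal_mul, mul_diagonal,
      transpose_apply, smul_eq_mul] at h
    rw [h]; ring
  have hk1 : k = 1 := by
    by_contra hne
    let x : Fin (2 * k) := ⟨0, by omega⟩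
    let y : Fin (2 * k) := ⟨1, by omega⟩
    let z : Fin (2 * k) := ⟨2, by omega⟩
    have hxy : x ≠ y := by simp [x, y]
    have hxz : x ≠ z := by simp [x, z]
    have hyz : y ≠ z := by simp [y, z]
    have h := Finset.sum_le_sum_of_subset_of_nonneg (Finset.subset_univ {y, z})
      (f := fun j => P x j ^ 2) fun _ _ _ => sq_nonneg _
    rw [sum_sq_row_of_orthogonal hP, Finset.sum_pair hyz, hsq hxy, hsq hxz] at h
    norm_num at h
  subst hk1
  have ha0 : a ≠ 0 := by
    rintro rfl
    have h : 0 < ∑ i, α i ^ 2 := Finset.sum_pos (fun i _ => hd i) ⟨0, Finset.mem_univ _⟩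
    rw [← ha] at h
    norm_num at h
  have hP00 : P 0 0 = 0 := by simpa using hprod 0 0
  have hP11 : P 1 1 = 0 := by simpa using hprod 1 1
  have hP01 : P 0 1 ^ 2 = 1 := hsq (by decide)
  have hP10 : P 1 0 = -P 0 1 := by
    have h := hprod 0 1
    rw [if_neg (by decide)] at h
    linear_combination P 0 1 * h - P 1 0 * hP01
  have ha' : a ^ 2 = α 0 ^ 2 + α 1 ^ 2 := by simpa [Fin.sum_univ_two] using ha
  have hK (i j : Fin 2) {c : ℝ} (h : a * K i j = a * c) : K i j = c := mul_left_cancel₀ ha0 h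
  have hK00 : K 0 0 = 0 := hK 0 0 (by rw [hentry, hP00]; ring)
  have hK11 : K 1 1 = 0 := hK 1 1 (by rw [hentry, hP11]; ring)
  have hK01 : K 0 1 = -a * P 0 1 :=
    hK 0 1 (by rw [hentry, hP10]; linear_combination P 0 1 * ha')
  have hK10 : K 1 0 = a * P 0 1 :=
    hK 1 0 (by rw [hentry, hP10]; linear_combination -P 0 1 * ha')
  have hsign : a.sign * a.sign = 1 := by
    rcases Real.sign_apply_eq_of_ne_zero a ha0 with h | h <;> rw [h] <;> norm_num
  have habs : a.sign * |a| = a := by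
    rcases lt_or_gt_of_ne ha0 with h | h
    · rw [Real.sign_of_neg h, abs_of_neg h]; ring
    · rw [Real.sign_of_pos h, abs_of_pos h]; ring
  refine ⟨rfl, -(a.sign * P 0 1), ?_, ?_, ?_⟩
  · rw [← sq_eq_one_iff]
    linear_combination a.sign * a.sign * hP01 + hsign
  · rw [← ha, Real.sqrt_sq_eq_abs]
    have hK01' : K 0 1 = -(a.sign * P 0 1) * |a| := by
      rw [hK01]; linear_combination P 0 1 * habs
    have hK10' : K 1 0 = -(-(a.sign * P 0 1) * |a|) := by
      rw [hK10]; linear_combination -P 0 1 * habs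
    intro i j
    fin_cases i <;> fin_cases j <;> simp [hK00, hK11, hK01', hK10']
  · have hP01' : P 0 1 = -(a.sign * -(a.sign * P 0 1)) := by
      linear_combination -P 0 1 * hsign
    have hP10' : P 1 0 = a.sign * -(a.sign * P 0 1) := by
      rw [hP10]; linear_combination P 0 1 * hsign
    intro i j
    fin_cases i <;> fin_cases j
    · simpa using hP00
    · simpa using hP01'
    · simpa using hP10'
    · simpa using hP11
end
end

section
/- Let h be a 3-step nilpotent real Lie algebra with dim Z(h) = 1 and let ⟨·,·⟩ be a Lorentzian inner product on h such that Z(h) is nondegenerate. Then ⟨·,·⟩ is Einstein if and only if h is Ricci-flat and one of the following holds: (i) dim h = 6 and h is isomorphic to L_{6,19}(−1), i.e. h has a basis (f₁,…,f₆) in which the non-vanishing brackets are [f₁,f₂] = f₄, [f₁,f₃] = f₅, [f₂,f₄] = f₆, [f₃,f₅] = −f₆, and the metric is ⟨·,·⟩ = f₁*⊗f₁* + 2 f₂*⊗f₂* + 2 f₃*⊗f₃* + 4α⁴ f₆*⊗f₆* − 2α²(f₄*⊗f₅* + f₅*⊗f₄*) for some α ≠ 0; or (ii) dim h = 7 and h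 is isomorphic to the nilpotent Lie algebra 147E: there is a basis (f₁,…,f₇) of h in which the non-vanishing brackets are [f₁,f₂] = f₅, [f₁,f₃] = f₆, [f₂,f₃] = f₄, [f₆,f₂] = (1−r) f₇, [f₅,f₃] = −r f₇, [f₄,f₁] = f₇ with 0 < r < 1, and the metric is ⟨·,·⟩ = f₁*⊗f₁* + f₂*⊗f₂* + f₃*⊗f₃* − a f₄*⊗f₄* + a r f₅*⊗f₅* + a(1−r) f₆*⊗f₆* + a² f₇*⊗f₇* for some a > 0. -/
open Module LinearMap

noncomputable section

/-- A bilinear form is Lorentzian if it admits an orthonormal basis with exactly one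
timelike vector, i.e. it has signature `(1, dim − 1)`. -/
def IsLorentzianForm {H : Type*} [AddCommGroup H] [Module ℝ H]
    (B : H →ₗ[ℝ] H →ₗ[ℝ] ℝ) : Prop :=
  ∃ (n : ℕ) (b : Basis (Fin (n + 1)) ℝ H),
    (∀ i j, i ≠ j → B (b i) (b j) = 0) ∧
    B (b 0) (b 0) = -1 ∧ ∀ i, i ≠ 0 → B (b i) (b i) = 1

section Bilinear
variable {V : Type*} [AddCommGroup V] [Module ℝ V]

theorem exists_simultaneous_basis [FiniteDimensional ℝ V] (q g : V →ₗ[ℝ] V →ₗ[ℝ] ℝ)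
    (hq : ∀ u v, q u v = q v u) (hpos : ∀ v, v ≠ 0 → 0 < q v v) (hg : ∀ u v, g u v = g v u) :
    ∃ b : Basis (Fin (finrank ℝ V)) ℝ V,
      (∀ i j, q (b i) (b j) = if i = j then 1 else 0) ∧ ∀ i j, i ≠ j → g (b i) (b j) = 0 := by
  let core : InnerProductSpace.Core ℝ V :=
    { inner := fun u v => q u v
      conj_inner_symm := fun u v => by simp [hq u v]
      re_inner_nonneg := fun v => by
        by_cases h : v = 0
        · simp [h]
        · simpa using (hpos v h).le
      add_left := fun u v w => by simp
      smul_left := fun u v r => by simp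
      definite := fun v h => by
        by_contra hv
        exact (hpos v hv).ne' h }
  let _ : NormedAddCommGroup V := core.toNormedAddCommGroup
  let _ : InnerProductSpace ℝ V := InnerProductSpace.ofCore core.toCore
  have hin : ∀ u v : V, inner ℝ u v = q u v := fun u v => rfl
  let G : V →ₗ[ℝ] V :=
    { toFun := fun u => (InnerProductSpace.toDual ℝ V).symm (LinearMap.toContinuousLinearMap (g u))
      map_add' := fun u v => by simp
      map_smul' := fun r v => by simp }
  have hG : ∀ u v, inner ℝ (G u) v = g u v := fun u v => by
    simp [G, InnerProductSpace.toDual_symm_apply]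
  have hGs : G.IsSymmetric := fun u v => by
    rw [hG, real_inner_comm, hG, hg]
  have hn : finrank ℝ V = finrank ℝ V := rfl
  refine ⟨(hGs.eigenvectorBasis hn).toBasis, fun i j => ?_, fun i j hij => ?_⟩
  · rw [← hin]
    simpa using orthonormal_iff_ite.mp (hGs.eigenvectorBasis hn).orthonormal i j
  · rw [← hG]
    have := orthonormal_iff_ite.mp (hGs.eigenvectorBasis hn).orthonormal i j
    simp only [OrthonormalBasis.coe_toBasis]
    rw [hGs.apply_eigenvectorBasis, inner_smul_left, this]
    simp [hij]

variable {B : V →ₗ[ℝ] V →ₗ[ℝ] ℝ}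

theorem exists_orthonormal_complement [FiniteDimensional ℝ V] (hB : ∀ u v, B u v = B v u)
    {ι : Type*} (v : ι → V)
    (hpos : ∀ x, (∀ i, B (v i) x = 0) → x ≠ 0 → 0 < B x x) :
    ∃ (m : ℕ) (y : Fin m → V), (∀ i j, B (v i) (y j) = 0) ∧
      (∀ i j, B (y i) (y j) = if i = j then 1 else 0) ∧
      ∀ x, (∀ i, B (v i) x = 0) → (∀ j, B (y j) x = 0) → x = 0 := by
  let W : Submodule ℝ V := ⨅ i, LinearMap.ker (B (v i))
  have hW : ∀ x, x ∈ W ↔ ∀ i, B (v i) x = 0 := fun x => by simp [W]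
  let q : W →ₗ[ℝ] W →ₗ[ℝ] ℝ := B.compl₁₂ W.subtype W.subtype
  obtain ⟨b, hb, -⟩ := exists_simultaneous_basis q 0 (fun u v => hB _ _)
    (fun x hx => hpos x ((hW x).1 x.2) (by simpa using hx)) (by simp)
  refine ⟨_, fun j => (b j : V), fun i j => (hW _).1 (b j).2 i, fun i j => hb i j,
    fun x hx hxb => ?_⟩
  by_contra hne
  have hself : B x x = 0 := by
    have h1 : q ⟨x, (hW x).2 hx⟩ = 0 := b.ext fun j => by
      change B x (b j) = 0
      rw [hB]; exact hxb j
    exact congrArg (fun f => f ⟨x, (hW x).2 hx⟩) h1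
  exact (hpos x hx hne).ne' hself

theorem exists_basis_of_biorthogonal {ι : Type*} [Fintype ι] [DecidableEq ι]
    (w v : ι → V) (g : ι → ℝ)
    (hv : ∀ i j, B (w i) (v j) = if i = j then g i else 0) (hg : ∀ i, g i ≠ 0)
    (hc : ∀ x, (∀ i, B (w i) x = 0) → x = 0) : ∃ e : Basis ι ℝ V, ∀ i, e i = v i := by
  have key : ∀ (s : ι → ℝ) i, B (w i) (∑ j, s j • v j) = s i * g i := fun s i => by
    simp [hv]
  have hli : LinearIndependent ℝ v := by
    rw [Fintype.linearIndependent_iff]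
    intro s hs i
    have := key s i
    rw [hs] at this
    simpa [hg i] using this.symm
  refine ⟨Basis.mk hli (fun x _ => ?_), Basis.mk_apply hli _⟩
  have : x = ∑ j, (B (w j) x / g j) • v j := by
    rw [← sub_eq_zero]
    refine hc _ fun i => ?_
    rw [map_sub, key]
    rw [div_mul_cancel₀ _ (hg i), sub_self]
  rw [this]
  exact Submodule.sum_mem _ fun j _ => Submodule.smul_mem _ _ (Submodule.subset_span ⟨j, rfl⟩)

theorem exists_orthogonal_basis {ι : Type*} [Fintype ι] [DecidableEq ι]
    (v : ι → V) (g : ι → ℝ)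
    (hv : ∀ i j, B (v i) (v j) = if i = j then g i else 0) (hg : ∀ i, g i ≠ 0)
    (hc : ∀ x, (∀ i, B (v i) x = 0) → x = 0) : ∃ e : Basis ι ℝ V, ∀ i, e i = v i :=
  exists_basis_of_biorthogonal v v g hv hg hc

theorem repr_eq_div {ι : Type*} [Fintype ι] [DecidableEq ι] {e : Basis ι ℝ V} {g : ι → ℝ}
    (he : ∀ i j, B (e i) (e j) = if i = j then g i else 0) (hg : ∀ i, g i ≠ 0) (x : V) (i : ι) :
    e.repr x i = B (e i) x / g i := by
  have : B (e i) x = e.repr x i * g i := by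
    conv_lhs => rw [← e.sum_repr x, map_sum]
    simp [he, -Basis.sum_repr]
  rw [this, mul_div_cancel_right₀ _ (hg i)]

theorem parseval {ι : Type*} [Fintype ι] [DecidableEq ι] {e : Basis ι ℝ V} {g : ι → ℝ}
    (he : ∀ i j, B (e i) (e j) = if i = j then g i else 0) (hg : ∀ i, g i ≠ 0)
    (hB : ∀ u v, B u v = B v u) (x y : V) :
    B x y = ∑ i, B x (e i) * B y (e i) / g i := by
  conv_lhs => rw [← e.sum_repr y]
  simp only [map_sum, map_smul, repr_eq_div he hg, smul_eq_mul]
  refine Finset.sum_congr rfl fun i _ => ?_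
  rw [hB y]; ring

theorem trace_eq_sum_div {ι : Type*} [Fintype ι] [DecidableEq ι] {e : Basis ι ℝ V} {g : ι → ℝ}
    (he : ∀ i j, B (e i) (e j) = if i = j then g i else 0) (hg : ∀ i, g i ≠ 0)
    (A : Module.End ℝ V) :
    LinearMap.trace ℝ V A = ∑ i, B (e i) (A (e i)) / g i := by
  rw [LinearMap.trace_eq_matrix_trace ℝ e, Matrix.trace]
  simp [LinearMap.toMatrix_apply, repr_eq_div he hg]

end Bilinear

section Lie
variable {H : Type*} [LieRing H] [LieAlgebra ℝ H]  {B : H →ₗ[ℝ] H →ₗ[ℝ] ℝ}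

/-- The Ricci curvature, written in an orthogonal basis `e` with `⟨e i, e i⟩ = g i`. -/
def ricciSum (B : H →ₗ[ℝ] H →ₗ[ℝ] ℝ) {ι : Type*} [Fintype ι] (e : ι → H)
    (g : ι → ℝ) (u v : H) : ℝ :=
  -(1/2) * ∑ i, B ⁅u, e i⁆ ⁅v, e i⁆ / g i +
    (1/4) * ∑ i, ∑ j, B u ⁅e i, e j⁆ * B v ⁅e i, e j⁆ / (g i * g j)

theorem ricci_eq_ricciSum (hB : ∀ u v, B u v = B v u)
    (adStar : H → Module.End ℝ H) (hadStar : ∀ u v w : H, B (adStar u v) w = B v ⁅u, w⁆)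
    (Jm : H → Module.End ℝ H) (hJm : ∀ u v w : H, B (Jm u v) w = B u ⁅v, w⁆)
    {ι : Type*} [Fintype ι] [DecidableEq ι] {e : Basis ι ℝ H} {g : ι → ℝ}
    (he : ∀ i j, B (e i) (e j) = if i = j then g i else 0) (hg : ∀ i, g i ≠ 0) (u v : H) :
    -(1/2) * LinearMap.trace ℝ H ((LieAlgebra.ad ℝ H u : Module.End ℝ H) ∘ₗ adStar v)
        - (1/4) * LinearMap.trace ℝ H (Jm u ∘ₗ Jm v) = ricciSum B e g u v := by
  have h1 : LinearMap.trace ℝ H ((LieAlgebra.ad ℝ H u : Module.End ℝ H) ∘ₗ adStar v)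
      = ∑ i, B ⁅u, e i⁆ ⁅v, e i⁆ / g i := by
    rw [← Module.End.mul_eq_comp, LinearMap.trace_mul_comm, trace_eq_sum_div he hg]
    refine Finset.sum_congr rfl fun i _ => ?_
    simp only [Module.End.mul_apply, LieAlgebra.ad_apply]
    rw [hB, hadStar]
  have h2 : LinearMap.trace ℝ H (Jm u ∘ₗ Jm v)
      = - ∑ i, ∑ j, B u ⁅e i, e j⁆ * B v ⁅e i, e j⁆ / (g i * g j) := by
    rw [trace_eq_sum_div he hg, ← Finset.sum_neg_distrib]
    refine Finset.sum_congr rfl fun i _ => ?_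
    have : B (e i) ((Jm u ∘ₗ Jm v) (e i)) = - B (Jm u (e i)) (Jm v (e i)) := by
      rw [LinearMap.comp_apply, hB, hJm, hJm, ← lie_skew, map_neg]
    rw [this, parseval he hg hB, neg_div, Finset.sum_div]
    congr 1
    refine Finset.sum_congr rfl fun j _ => ?_
    rw [hJm, hJm, div_div, mul_comm (g j)]
  rw [h1, h2, ricciSum]
  ring

theorem sum_ricciSum (hB : ∀ u v, B u v = B v u)
    {ι : Type*} [Fintype ι] [DecidableEq ι] {e : Basis ι ℝ H} {g : ι → ℝ}
    (he : ∀ i j, B (e i) (e j) = if i = j then g i else 0) (hg : ∀ i, g i ≠ 0) {lam : ℝ}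
    (hE : ∀ u v, ricciSum B e g u v = lam * B u v) :
    ∑ i, ∑ j, B ⁅e i, e j⁆ ⁅e i, e j⁆ / (g i * g j) = -4 * Fintype.card ι * lam := by
  set Q := ∑ i, ∑ j, B ⁅e i, e j⁆ ⁅e i, e j⁆ / (g i * g j) with hQ
  have h1 : ∑ k, ricciSum B e g (e k) (e k) / g k = -(1/4) * Q := by
    have h2 : ∑ k, (∑ i, ∑ j, B (e k) ⁅e i, e j⁆ * B (e k) ⁅e i, e j⁆ / (g i * g j)) / g k = Q := by
      simp only [Finset.sum_div]
      rw [Finset.sum_comm, hQ]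
      refine Finset.sum_congr rfl fun i _ => ?_
      rw [Finset.sum_comm]
      refine Finset.sum_congr rfl fun j _ => ?_
      rw [parseval he hg hB, Finset.sum_div]
      refine Finset.sum_congr rfl fun k _ => ?_
      rw [hB (e k)]; ring
    have h3 : ∑ k, (∑ i, B ⁅e k, e i⁆ ⁅e k, e i⁆ / g i) / g k = Q := by
      simp only [Finset.sum_div, hQ, div_div]
      refine Finset.sum_congr rfl fun i _ => Finset.sum_congr rfl fun j _ => by rw [mul_comm (g j)]
    simp only [ricciSum, add_div, mul_div_assoc, Finset.sum_add_distrib, ← Finset.mul_sum]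
    simp only [mul_div_assoc] at h2
    rw [h2, h3]; ring
  have h4 : ∑ k, ricciSum B e g (e k) (e k) / g k = Fintype.card ι * lam := by
    have : ∀ k, ricciSum B e g (e k) (e k) / g k = lam := fun k => by
      rw [hE, he]; simp [hg k]
    simp [this]
  linarith

end Lie

/-- The facts used about a three-step nilpotent Lorentzian Einstein Lie algebra with center
spanned by `z`. -/
structure ThreeStepEinstein {H : Type*} [LieRing H] [LieAlgebra ℝ H]
    (B : H →ₗ[ℝ] H →ₗ[ℝ] ℝ) (z : H) (lam : ℝ) : Prop where
  symm : ∀ u v, B u v = B v u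
  pos_of_orthogonal : ∀ t v, B t t < 0 → B t v = 0 → v ≠ 0 → 0 < B v v
  exists_timelike : ∃ t, B t t < 0
  lie_lie_lie : ∀ a b c d : H, ⁅a, ⁅b, ⁅c, d⁆⁆⁆ = 0
  exists_lie_lie_ne_zero : ∃ a b c : H, ⁅a, ⁅b, c⁆⁆ ≠ 0
  lie_center : ∀ v : H, ⁅v, z⁆ = 0
  eq_smul_of_central : ∀ v : H, (∀ w : H, ⁅w, v⁆ = 0) → ∃ c : ℝ, v = c • z
  einstein : ∀ {ι : Type} [Fintype ι] [DecidableEq ι] (e : Basis ι ℝ H) (g : ι → ℝ),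
    (∀ i j, B (e i) (e j) = if i = j then g i else 0) → (∀ i, g i ≠ 0) →
      ∀ u v, ricciSum B e g u v = lam * B u v

namespace ThreeStepEinstein
variable {H : Type*} [LieRing H] [LieAlgebra ℝ H]
  {B : H →ₗ[ℝ] H →ₗ[ℝ] ℝ} {z : H} {lam : ℝ}

theorem nonneg_of_orthogonal (h : ThreeStepEinstein B z lam) {t v : H} (ht : B t t < 0)
    (hv : B t v = 0) : 0 ≤ B v v := by
  by_cases h0 : v = 0
  · simp [h0]
  · exact (h.pos_of_orthogonal t v ht hv h0).le

theorem exists_basis [FiniteDimensional ℝ H] (h : ThreeStepEinstein B z lam)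
    {ι : Type} [Fintype ι] [DecidableEq ι] (v : ι → H) (g : ι → ℝ)
    (hv : ∀ i j, B (v i) (v j) = if i = j then g i else 0) (hg : ∀ i, g i ≠ 0)
    (hpos : ∀ x, (∀ i, B (v i) x = 0) → x ≠ 0 → 0 < B x x) :
    ∃ (m : ℕ) (e : Basis (ι ⊕ Fin m) ℝ H), (∀ i, e (.inl i) = v i) ∧
      (∀ i j, B (e i) (e j) = if i = j then Sum.elim g (fun _ => 1) i else 0) ∧
      (∀ i, Sum.elim g (fun _ : Fin m => (1 : ℝ)) i ≠ 0) ∧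
      ∀ u v, ricciSum B e (Sum.elim g (fun _ => 1)) u v = lam * B u v := by
  obtain ⟨m, y, hvy, hyy, hy⟩ := exists_orthonormal_complement h.symm v hpos
  have hG : ∀ i, Sum.elim g (fun _ : Fin m => (1 : ℝ)) i ≠ 0 := by
    rintro (i | i)
    · exact hg i
    · exact one_ne_zero
  have ho : ∀ i j, B (Sum.elim v y i) (Sum.elim v y j) =
      if i = j then Sum.elim g (fun _ => 1) i else 0 := by
    rintro (i | i) (j | j)
    · simp [hv]
    · simp [hvy]
    · simp [h.symm (y i), hvy]
    · simp [hyy]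
  obtain ⟨e, he⟩ := exists_orthogonal_basis (Sum.elim v y) _ ho hG
    fun x hx => hy x (fun i => hx (.inl i)) fun j => hx (.inr j)
  have ho' : ∀ i j, B (e i) (e j) = if i = j then Sum.elim g (fun _ => 1) i else 0 := by
    intro i j
    rw [he, he, ho]
  exact ⟨m, e, fun i => he _, ho', hG, h.einstein e _ ho' hG⟩

theorem lie_basis_eq_zero {ι : Type*} (e : Basis ι ℝ H) {v : H} (hv : ∀ i, ⁅v, e i⁆ = 0) (w : H) :
    ⁅w, v⁆ = 0 := by
  have : (LieAlgebra.ad ℝ H v : H →ₗ[ℝ] H) = 0 := e.ext fun i => hv i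
  rw [← lie_skew, neg_eq_zero]
  exact congrArg (fun f => f w) this

theorem center_lie (h : ThreeStepEinstein B z lam) (v : H) : ⁅z, v⁆ = 0 := by
  rw [← lie_skew, h.lie_center, neg_zero]

theorem lie_lie_eq_smul (h : ThreeStepEinstein B z lam) (a b c : H) :
    ∃ s : ℝ, ⁅a, ⁅b, c⁆⁆ = s • z :=
  h.eq_smul_of_central _ fun _ => h.lie_lie_lie _ _ _ _

theorem lie_lie_lie_comm (h : ThreeStepEinstein B z lam) (a b c d : H) : ⁅⁅a, b⁆, ⁅c, d⁆⁆ = 0 := by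
  rw [lie_lie, h.lie_lie_lie, h.lie_lie_lie, sub_zero]

theorem center_not_timelike [FiniteDimensional ℝ H] (h : ThreeStepEinstein B z lam)
    (hz : B z z = -1) : False := by
  have hzneg : B z z < 0 := by rw [hz]; norm_num
  obtain ⟨m, e, hev, heo, hg, hE⟩ := h.exists_basis (fun _ : Unit => z) (fun _ => -1)
    (fun _ _ => by simp [hz]) (by simp) fun x hx => h.pos_of_orthogonal z x hzneg (hx ())
  have hJ : ∀ u : H, 0 ≤ ∑ i, ∑ j, B u ⁅e i, e j⁆ * B u ⁅e i, e j⁆ /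
      (Sum.elim (fun _ : Unit => (-1 : ℝ)) (fun _ : Fin m => (1 : ℝ)) i *
        Sum.elim (fun _ : Unit => (-1 : ℝ)) (fun _ : Fin m => (1 : ℝ)) j) := by
    intro u
    refine Finset.sum_nonneg fun i _ => Finset.sum_nonneg fun j _ => ?_
    rcases i with i | i
    · simp [hev, h.center_lie]
    rcases j with j | j
    · simp [hev, h.lie_center]
    · simp [mul_self_nonneg]
  have hlam : lam ≤ 0 := by
    have := hE z z
    rw [ricciSum, hz] at this
    simp only [h.center_lie, map_zero, zero_div, Finset.sum_const_zero, mul_zero] at this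
    linarith [hJ z]
  obtain ⟨a, b, c, habc⟩ := h.exists_lie_lie_ne_zero
  set d := ⁅b, c⁆ + B z ⁅b, c⁆ • z with hd
  have hzd : B z d = 0 := by simp [hd, hz]
  have hdd := h.nonneg_of_orthogonal hzneg hzd
  have hlie : ∀ w : H, ⁅d, w⁆ = ⁅⁅b, c⁆, w⁆ := fun w => by simp [hd, h.center_lie]
  have hs : ∀ w : H, ∃ s : ℝ, ⁅d, w⁆ = s • z := fun w => by
    obtain ⟨s, hs⟩ := h.lie_lie_eq_smul w b c
    exact ⟨-s, by rw [hlie, ← lie_skew, hs, neg_smul]⟩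
  choose s hs using hs
  have hsum := hE d d
  rw [ricciSum] at hsum
  have hT : ∑ i, B ⁅d, e i⁆ ⁅d, e i⁆ /
      Sum.elim (fun _ : Unit => (-1 : ℝ)) (fun _ : Fin m => (1 : ℝ)) i
      = - ∑ i : Fin m, s (e (.inr i)) ^ 2 := by
    rw [Fintype.sum_sum_type]
    simp [hev, h.lie_center, hs (e (Sum.inr _)), hz, pow_two]
  rw [hT] at hsum
  have hprod : lam * B d d ≤ 0 := mul_nonpos_of_nonpos_of_nonneg hlam hdd
  have h0 : ∑ i : Fin m, s (e (.inr i)) ^ 2 = 0 :=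
    le_antisymm (by linarith [hJ d]) (Finset.sum_nonneg fun _ _ => sq_nonneg _)
  rw [Finset.sum_eq_zero_iff_of_nonneg fun _ _ => sq_nonneg _] at h0
  refine habc ?_
  have := lie_basis_eq_zero e (v := d) ?_ a
  · rw [← lie_skew, hlie, lie_skew] at this
    exact this
  · rintro (i | i)
    · rw [hev, h.lie_center]
    · rw [hs, pow_eq_zero_iff two_ne_zero |>.1 (h0 i (Finset.mem_univ _)), zero_smul]

theorem nonneg_of_orthogonal_lie [FiniteDimensional ℝ H] (h : ThreeStepEinstein B z lam)
    (hz : B z z = 1) {t : H} (ht : ∀ a b : H, B t ⁅a, b⁆ = 0) : 0 ≤ B t t := by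
  by_contra! hneg
  wlog hunit : B t t = -1 generalizing t
  · refine this (t := (√(-B t t))⁻¹ • t) (by simp [ht]) ?_ ?_ <;>
    · have h1 : 0 < √(-B t t) := Real.sqrt_pos.2 (by linarith)
      have h2 : √(-B t t) ^ 2 = -B t t := Real.sq_sqrt (by linarith)
      have h3 : B ((√(-B t t))⁻¹ • t) ((√(-B t t))⁻¹ • t) = -1 := by
        simp only [map_smul, LinearMap.smul_apply, smul_eq_mul]
        field_simp
        rw [h2]; ring
      rw [h3] <;> norm_num
  obtain ⟨m, e, hev, heo, hg, hE⟩ := h.exists_basis (fun _ : Unit => t) (fun _ => -1)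
    (fun _ _ => by simp [hunit]) (by simp) fun x hx => h.pos_of_orthogonal t x hneg (hx ())
  set R := ∑ k : Fin m, B ⁅t, e (.inr k)⁆ ⁅t, e (.inr k)⁆ with hR
  have hnn : ∀ a b : H, 0 ≤ B ⁅a, b⁆ ⁅a, b⁆ := fun a b => h.nonneg_of_orthogonal hneg (ht a b)
  have hRnn : 0 ≤ R := Finset.sum_nonneg fun _ _ => hnn _ _
  have hric := hE t t
  simp [ricciSum, ht, hunit, Fintype.sum_sum_type, hev, ← hR] at hric
  have hQ := sum_ricciSum h.symm heo hg hE
  have hR' : ∑ k : Fin m, B ⁅e (.inr k), t⁆ ⁅e (.inr k), t⁆ = R := by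
    refine Finset.sum_congr rfl fun k _ => ?_
    rw [← lie_skew t, map_neg, map_neg, LinearMap.neg_apply, neg_neg]
  have hQ' : 0 ≤ ∑ k : Fin m, ∑ l : Fin m, B ⁅e (.inr k), e (.inr l)⁆ ⁅e (.inr k), e (.inr l)⁆ :=
    Finset.sum_nonneg fun _ _ => Finset.sum_nonneg fun _ _ => hnn _ _
  simp [Fintype.sum_sum_type, hev, Finset.sum_add_distrib, div_neg, ← hR, hR'] at hQ
  have hm : (0 : ℝ) ≤ m := Nat.cast_nonneg m
  have hR0 : R = 0 := by
    rcases Nat.eq_zero_or_pos m with rfl | hm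
    · simp [hR]
    · have : (1 : ℝ) ≤ m := by exact_mod_cast hm
      nlinarith
  have hzero : ∀ k : Fin m, ⁅t, e (.inr k)⁆ = 0 := fun k => by
    rw [hR, Finset.sum_eq_zero_iff_of_nonneg fun _ _ => hnn _ _] at hR0
    by_contra hne
    exact (h.pos_of_orthogonal t _ hneg (ht _ _) hne).ne' (hR0 k (Finset.mem_univ _))
  obtain ⟨c, hc⟩ := h.eq_smul_of_central t <| lie_basis_eq_zero e <| by
    rintro (i | i)
    · rw [hev, lie_self]
    · exact hzero i
  rw [hc] at hneg
  simp [hz] at hneg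
  nlinarith

/-- The span of all brackets. -/
def bracketSpan (H : Type*) [LieRing H] [LieAlgebra ℝ H] : Submodule ℝ H :=
  Submodule.span ℝ {x | ∃ a b : H, ⁅a, b⁆ = x}

theorem lie_mem_bracketSpan (a b : H) : ⁅a, b⁆ ∈ bracketSpan H :=
  Submodule.subset_span ⟨a, b, rfl⟩

theorem eq_zero_of_mem_bracketSpan {M : Type*} [AddCommGroup M] [Module ℝ M] (f : H →ₗ[ℝ] M)
    (hf : ∀ a b : H, f ⁅a, b⁆ = 0) {x : H} (hx : x ∈ bracketSpan H) : f x = 0 := by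
  have : bracketSpan H ≤ LinearMap.ker f := Submodule.span_le.2 <| by
    rintro _ ⟨a, b, rfl⟩
    exact hf a b
  exact this hx

theorem lie_mem_bracketSpan_eq_zero (h : ThreeStepEinstein B z lam) {d d' : H}
    (hd : d ∈ bracketSpan H) (hd' : d' ∈ bracketSpan H) : ⁅d, d'⁆ = 0 := by
  refine eq_zero_of_mem_bracketSpan (LieAlgebra.ad ℝ H d : H →ₗ[ℝ] H) (fun a b => ?_) hd'
  change ⁅d, ⁅a, b⁆⁆ = 0
  rw [← lie_skew, neg_eq_zero]
  exact eq_zero_of_mem_bracketSpan (LieAlgebra.ad ℝ H ⁅a, b⁆ : H →ₗ[ℝ] H)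
    (fun c d => h.lie_lie_lie_comm a b c d) hd

theorem lie_eq_smul_of_mem (h : ThreeStepEinstein B z lam) (hz : B z z = 1) {d : H}
    (hd : d ∈ bracketSpan H) (w : H) : ⁅d, w⁆ = B z ⁅d, w⁆ • z := by
  obtain ⟨s, hs⟩ := h.eq_smul_of_central ⁅d, w⁆ fun v => by
    rw [← lie_skew d w, lie_neg, neg_eq_zero]
    refine eq_zero_of_mem_bracketSpan
      ((LieAlgebra.ad ℝ H v : H →ₗ[ℝ] H) ∘ₗ (LieAlgebra.ad ℝ H w : H →ₗ[ℝ] H)) (fun a b => ?_) hd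
    exact h.lie_lie_lie v w a b
  rw [hs]; simp [hz]

theorem mem_bracketSpan_of_orthogonal [FiniteDimensional ℝ H] (h : ThreeStepEinstein B z lam)
    (hnd : ∀ u : H, (∀ v : H, B u v = 0) → u = 0) {x : H}
    (hx : ∀ v, (∀ a b : H, B v ⁅a, b⁆ = 0) → B v x = 0) : x ∈ bracketSpan H := by
  have hB : LinearMap.BilinForm.Nondegenerate B := by
    refine ⟨fun u hu => hnd u hu, fun u hu => hnd u fun v => ?_⟩
    rw [h.symm]; exact hu v
  have hr : LinearMap.BilinForm.IsRefl B := fun u v huv => by rw [h.symm]; exact huv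
  rw [← LinearMap.BilinForm.orthogonal_orthogonal hB hr (bracketSpan H),
    LinearMap.BilinForm.mem_orthogonal_iff]
  intro v hv
  refine hx v fun a b => ?_
  rw [h.symm]
  exact (LinearMap.BilinForm.mem_orthogonal_iff.1 hv) _ (lie_mem_bracketSpan a b)

theorem smul_of_null_orthogonal (h : ThreeStepEinstein B z lam) {e k : H} (he0 : e ≠ 0)
    (he : B e e = 0) (hk : B k k = 0) (hek : B e k = 0) : ∃ c : ℝ, k = c • e := by
  obtain ⟨t, ht⟩ := h.exists_timelike
  have hte : B t e ≠ 0 := fun h0 => (h.pos_of_orthogonal t e ht h0 he0).ne' he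
  refine ⟨B t k / B t e, ?_⟩
  by_contra hne
  have := h.pos_of_orthogonal t (k - (B t k / B t e) • e) ht (by simp [hte]) (sub_ne_zero.2 hne)
  simp [he, hk, hek, h.symm k e] at this

theorem exists_unit_timelike (h : ThreeStepEinstein B z lam) : ∃ t, B t t = -1 := by
  obtain ⟨t, ht⟩ := h.exists_timelike
  have h1 : 0 < √(-B t t) := Real.sqrt_pos.2 (by linarith)
  have h2 : √(-B t t) ^ 2 = -B t t := Real.sq_sqrt (by linarith)
  refine ⟨(√(-B t t))⁻¹ • t, ?_⟩
  simp only [map_smul, LinearMap.smul_apply, smul_eq_mul]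
  field_simp
  rw [h2]; ring

theorem not_null_of_mem_bracketSpan [FiniteDimensional ℝ H] (h : ThreeStepEinstein B z lam)
    (hz : B z z = 1) (K : H →ₗ[ℝ] H) (hK : ∀ v w, B (K v) w = B z ⁅v, w⁆)
    {e t : H} (he : ∀ a b : H, B e ⁅a, b⁆ = 0) (hmem : e ∈ bracketSpan H) (hee : B e e = 0)
    (ht : B t t = -1) (hte : B t e = -1) : False := by
  have hlie : ∀ w, ⁅e, w⁆ = B (K e) w • z := fun w => by
    rw [hK]; exact h.lie_eq_smul_of_mem hz hmem w
  have het : B e t = -1 := by rw [h.symm, hte]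
  have htneg : B t t < 0 := by rw [ht]; norm_num
  have he0 : e ≠ 0 := by rintro rfl; simp at hte
  obtain ⟨f, hf⟩ : ∃ f, f = e - t := ⟨_, rfl⟩
  have htf : B t f = 0 := by simp [hf, ht, hte]
  have hff : B f f = 1 := by simp [hf, ht, hte, hee, het]
  obtain ⟨m, b, hbv, hbo, hg, hE⟩ := h.exists_basis ![t, f] ![-1, 1]
    (by intro i j; fin_cases i <;> fin_cases j <;> simp [ht, htf, h.symm f t, hff])
    (by intro i; fin_cases i <;> simp)
    fun x hx => h.pos_of_orthogonal t x htneg (hx 0)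
  have hkk : B (K e) (K e) = 0 := by
    have := hE e e
    simp only [ricciSum, he, hlie, map_smul, LinearMap.smul_apply, hz, smul_eq_mul, mul_one, hee,
      mul_zero, zero_div, Finset.sum_const_zero, add_zero] at this
    rw [← parseval hbo hg h.symm] at this
    linarith
  obtain ⟨c, hc⟩ := h.smul_of_null_orthogonal he0 hee hkk (by rw [h.symm, hK]; simp)
  simp only [hc, map_smul, LinearMap.smul_apply, smul_eq_mul] at hlie
  have hc0 : c ≠ 0 := by
    rintro rfl
    obtain ⟨s, hs⟩ := h.eq_smul_of_central e fun w => by rw [← lie_skew, hlie]; simp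
    rw [hs] at hee
    have : s = 0 := by simpa [hz] using hee
    exact he0 (by rw [hs, this, zero_smul])
  have hlam : lam = c ^ 2 / 2 := by
    have h1 := hE e t
    have h2 : B e (K t) = c := by
      rw [h.symm, hK, ← lie_skew, map_neg, hlie]
      simp [hz, het]
    have h3 : ∀ w, B (c • z) ⁅t, w⁆ = c * B (K t) w := fun w => by simp [hK]
    have h4 := parseval hbo hg h.symm e (K t)
    have h5 : ∑ i, B ⁅e, b i⁆ ⁅t, b i⁆ / Sum.elim ![-1, 1] (fun _ => 1) i = c * B e (K t) := by
      rw [h4, Finset.mul_sum]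
      refine Finset.sum_congr rfl fun i _ => ?_
      rw [hlie]
      simp only [map_smul, LinearMap.smul_apply, smul_eq_mul, ← hK]
      ring
    rw [ricciSum, h5] at h1
    simp only [he, zero_mul, zero_div, Finset.sum_const_zero, mul_zero, h2, het] at h1
    linarith
  have hnn : ∀ x y : H, 0 ≤ B ⁅x, y⁆ ⁅x, y⁆ := fun x y => by
    have := h.nonneg_of_orthogonal (v := ⁅x, y⁆ + B t ⁅x, y⁆ • e) htneg (by simp [hte])
    simpa [he, hee, h.symm _ e] using this
  have hbt : b (.inl 0) = t := hbv 0
  have hbf : b (.inl 1) = f := hbv 1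
  have hlx : ∀ k : Fin m, ⁅f, b (.inr k)⁆ = -⁅t, b (.inr k)⁆ := fun k => by
    have h1 : B e (b (.inr k)) = 0 := by
      have h2 := hbo (.inl 0) (.inr k)
      have h3 := hbo (.inl 1) (.inr k)
      rw [hbt] at h2
      rw [hbf, hf] at h3
      simp at h2 h3
      linarith
    rw [hf, sub_lie, hlie, h1]; simp
  have hft : ⁅f, t⁆ = (-c) • z := by rw [hf, sub_lie, hlie, het]; simp
  have htf' : ⁅t, f⁆ = c • z := by rw [← lie_skew, hft]; simp
  have hsw : ∀ x y : H, B ⁅x, y⁆ ⁅x, y⁆ = B ⁅y, x⁆ ⁅y, x⁆ := fun x y => by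
    rw [← lie_skew x y, map_neg, map_neg, LinearMap.neg_apply, neg_neg]
  have hQ := sum_ricciSum h.symm hbo hg hE
  have hQ' : 0 ≤ ∑ k : Fin m, ∑ l : Fin m, B ⁅b (.inr k), b (.inr l)⁆ ⁅b (.inr k), b (.inr l)⁆ :=
    Finset.sum_nonneg fun _ _ => Finset.sum_nonneg fun _ _ => hnn _ _
  simp [Fintype.sum_sum_type, hbt, hbf, Finset.sum_add_distrib, div_neg, hft, htf', hz,
    hsw (b (.inr _)) t, hsw (b (.inr _)) f, hlx] at hQ
  have hm : (0 : ℝ) ≤ m := Nat.cast_nonneg m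
  have : 0 < c ^ 2 := by positivity
  nlinarith

theorem pos_of_orthogonal_lie [FiniteDimensional ℝ H] (h : ThreeStepEinstein B z lam)
    (hz : B z z = 1) (hnd : ∀ u : H, (∀ v : H, B u v = 0) → u = 0)
    (K : H →ₗ[ℝ] H) (hK : ∀ v w, B (K v) w = B z ⁅v, w⁆)
    {e : H} (he : ∀ a b : H, B e ⁅a, b⁆ = 0) (he0 : e ≠ 0) : 0 < B e e := by
  refine lt_of_le_of_ne (h.nonneg_of_orthogonal_lie hz he) fun hee => ?_
  replace hee := hee.symm
  have hmem : e ∈ bracketSpan H := h.mem_bracketSpan_of_orthogonal hnd fun v hv => by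
    by_contra hne
    have h1 : ∀ s : ℝ, 0 ≤ B v v + 2 * s * B v e := fun s => by
      have := h.nonneg_of_orthogonal_lie hz (t := v + s • e) (by simp [hv, he])
      simp [hee, h.symm e v] at this
      linarith
    have := h1 (-(B v v + 1) / (2 * B v e))
    have h2 : B v v + 2 * (-(B v v + 1) / (2 * B v e)) * B v e = -1 := by field_simp; ring
    linarith
  obtain ⟨t, ht⟩ := h.exists_unit_timelike
  have htneg : B t t < 0 := by rw [ht]; norm_num
  have hte : B t e ≠ 0 := fun h0 => (h.pos_of_orthogonal t e htneg h0 he0).ne' hee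
  refine h.not_null_of_mem_bracketSpan hz K hK (e := (-(B t e)⁻¹) • e) (t := t) ?_
    (Submodule.smul_mem _ _ hmem) ?_ ht ?_
  · simp [he]
  · simp [hee]
  · simp [hte]

end ThreeStepEinstein

section StructureConstants
variable {ι μ : Type*} [Fintype ι] [Fintype μ] {i₀ : ι} {g : ι → ℝ}
  {c : ι → ι ⊕ μ → ι ⊕ μ → ℝ} {κ : ι ⊕ μ → ι ⊕ μ → ℝ} {lam : ℝ}

theorem einstein_constant_nonneg
    (hR1 : 4 * lam = 2 * ∑ i, 1 / g i + ∑ j, ∑ k, κ j k ^ 2)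
    (hR2 : ∀ i, 4 * lam * g i = -2 + ∑ j, ∑ k, c i j k ^ 2)
    (hg : ∀ i, g i ≠ 0)
    (hR3 : ∀ i, -2 * lam = 1 / g i + (∑ k, ∑ l, c l (.inl i) k ^ 2 / g l) + ∑ k, κ (.inl i) k ^ 2)
    (hR4 : ∀ y, -2 * lam = (∑ k, ∑ l, c l (.inr y) k ^ 2 / g l) + ∑ k, κ (.inr y) k ^ 2) :
    0 ≤ lam ∧ ∑ i, 1 / g i = -lam * (6 * Fintype.card ι + 2 * Fintype.card μ + 4) := by
  have h2 : 4 * lam * Fintype.card ι = -2 * (∑ i, 1 / g i) + ∑ i, ∑ j, ∑ k, c i j k ^ 2 / g i := by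
    have : ∀ i, 4 * lam = -2 * (1 / g i) + ∑ j, ∑ k, c i j k ^ 2 / g i := fun i => by
      simp only [← Finset.sum_div]
      field_simp [hg i]
      linarith [hR2 i]
    calc 4 * lam * Fintype.card ι = ∑ i : ι, 4 * lam := by simp; ring
      _ = _ := by rw [Finset.sum_congr rfl fun i _ => this i, Finset.sum_add_distrib,
        ← Finset.mul_sum]
  have h34 : -2 * lam * (Fintype.card ι + Fintype.card μ) =
      (∑ i, 1 / g i) + (∑ i, ∑ j, ∑ k, c i j k ^ 2 / g i) + ∑ j, ∑ k, κ j k ^ 2 := by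
    have h3 : -2 * lam * Fintype.card ι = ∑ i, (1 / g i + (∑ k, ∑ l, c l (.inl i) k ^ 2 / g l) +
        ∑ k, κ (.inl i) k ^ 2) := by
      rw [← Finset.sum_congr rfl fun i _ => hR3 i]; simp; ring
    have h4 : -2 * lam * Fintype.card μ = ∑ y, ((∑ k, ∑ l, c l (.inr y) k ^ 2 / g l) +
        ∑ k, κ (.inr y) k ^ 2) := by
      rw [← Finset.sum_congr rfl fun i _ => hR4 i]; simp; ring
    have h5 : ∑ i, ∑ j, ∑ k, c i j k ^ 2 / g i = ∑ j, ∑ k, ∑ i, c i j k ^ 2 / g i := by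
      rw [Finset.sum_comm]
      exact Finset.sum_congr rfl fun j _ => Finset.sum_comm
    rw [h5, Fintype.sum_sum_type (fun j => ∑ k, ∑ i, c i j k ^ 2 / g i),
      Fintype.sum_sum_type (fun j => ∑ k, κ j k ^ 2), mul_add, h3, h4]
    simp only [Finset.sum_add_distrib]
    ring
  have hκ : 0 ≤ ∑ j, ∑ k, κ j k ^ 2 := by positivity
  have hd : (0 : ℝ) ≤ Fintype.card ι := Nat.cast_nonneg _
  have hm : (0 : ℝ) ≤ Fintype.card μ := Nat.cast_nonneg _
  have hΓ : ∑ i, 1 / g i = -lam * (6 * Fintype.card ι + 2 * Fintype.card μ + 4) := by linarith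
  refine ⟨?_, hΓ⟩
  by_contra! hneg
  rw [hΓ] at hR1
  nlinarith [mul_nonneg (neg_nonneg.2 hneg.le) hd, mul_nonneg (neg_nonneg.2 hneg.le) hm]

variable [DecidableEq ι]

/-- A skew-symmetric array has at least twice the mass of any of its rows. -/
theorem two_mul_row_le {J : Type*} [Fintype J] [DecidableEq J] {a : J → J → ℝ}
    (ha : ∀ j k, a j k = -a k j) (r : J) :
    2 * ∑ k, a r k ^ 2 + ∑ j ∈ Finset.univ.erase r, ∑ k ∈ Finset.univ.erase r, a j k ^ 2 =
      ∑ j, ∑ k, a j k ^ 2 := by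
  have hrr : a r r = 0 := by linarith [ha r r]
  have h1 : ∀ j, ∑ k, a j k ^ 2 = a j r ^ 2 + ∑ k ∈ Finset.univ.erase r, a j k ^ 2 := fun j =>
    (Finset.add_sum_erase _ _ (Finset.mem_univ r)).symm
  rw [← Finset.add_sum_erase _ (fun j => ∑ k, a j k ^ 2) (Finset.mem_univ r)]
  rw [Finset.sum_congr rfl fun j _ => h1 j, Finset.sum_add_distrib]
  have h2 : ∑ j ∈ Finset.univ.erase r, a j r ^ 2 = ∑ k, a r k ^ 2 := by
    rw [h1 r, hrr]
    simp only [zero_pow two_ne_zero, zero_add]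
    exact Finset.sum_congr rfl fun j _ => by rw [ha j r]; ring
  rw [h2]; ring

theorem einstein_flat [DecidableEq μ] (hg₀ : g i₀ < 0) (hgpos : ∀ i, i ≠ i₀ → 0 < g i)
    (hc : ∀ i j k, c i j k = -c i k j) (hκ : ∀ i k, κ (.inl i) k = 0)
    (hR1 : 4 * lam = 2 * ∑ i, 1 / g i + ∑ j, ∑ k, κ j k ^ 2)
    (hR2 : ∀ i, 4 * lam * g i = -2 + ∑ j, ∑ k, c i j k ^ 2)
    (hR3 : ∀ i, -2 * lam = 1 / g i + (∑ k, ∑ l, c l (.inl i) k ^ 2 / g l) + ∑ k, κ (.inl i) k ^ 2)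
    (hR4 : ∀ y, -2 * lam = (∑ k, ∑ l, c l (.inr y) k ^ 2 / g l) + ∑ k, κ (.inr y) k ^ 2) :
    lam = 0 ∧ (∀ j k, κ j k = 0) ∧ ∑ i, 1 / g i = 0 ∧ (∀ i, ∑ j, ∑ k, c i j k ^ 2 = 2) ∧
      (∀ k, c i₀ (.inl i₀) k = 0) ∧
      (∀ l, l ≠ i₀ → ∑ k, c l (.inl i₀) k ^ 2 = 1) ∧
      ∀ l, l ≠ i₀ → ∀ j k, j ≠ .inl i₀ → k ≠ .inl i₀ → c l j k = 0 := by
  have hg : ∀ i, g i ≠ 0 := fun i => by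
    by_cases h : i = i₀
    · exact h ▸ hg₀.ne
    · exact (hgpos i h).ne'
  obtain ⟨hlam, hΓ⟩ := einstein_constant_nonneg hR1 hR2 hg hR3 hR4
  set row : ι → ℝ := fun l => ∑ k, c l (.inl i₀) k ^ 2 with hrow
  set rest : ι → ℝ := fun l => ∑ j ∈ Finset.univ.erase (.inl i₀),
    ∑ k ∈ Finset.univ.erase (.inl i₀), c l j k ^ 2 with hrest
  have hrest0 : ∀ l, 0 ≤ rest l := fun l => by positivity
  have hrow0 : ∀ l, 0 ≤ row l := fun l => by positivity
  have hsplit : ∀ l, 2 * row l + rest l = 4 * lam * g l + 2 := fun l => by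
    linarith [two_mul_row_le (hc l) (.inl i₀), hR2 l]
  have h3 : -2 * lam = 1 / g i₀ + ∑ l, row l / g l := by
    have := hR3 i₀
    simp only [hκ, zero_pow two_ne_zero, Finset.sum_const_zero, add_zero] at this
    rw [this, Finset.sum_comm]
    simp only [hrow, Finset.sum_div]
  have hsum : ∀ f : ι → ℝ, ∑ l, f l = f i₀ + ∑ l ∈ Finset.univ.erase i₀, f l := fun f =>
    (Finset.add_sum_erase _ _ (Finset.mem_univ i₀)).symm
  have h4 : ∑ l ∈ Finset.univ.erase i₀, row l / g l =
      ∑ l ∈ Finset.univ.erase i₀, (1 / g l + 2 * lam - rest l / (2 * g l)) :=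
    Finset.sum_congr rfl fun l _ => by
      have := hsplit l
      field_simp [hg l]
      linarith
  have hS0 : 0 ≤ ∑ l ∈ Finset.univ.erase i₀, rest l / (2 * g l) :=
    Finset.sum_nonneg fun l hl => div_nonneg (hrest0 l)
      (by linarith [hgpos l (Finset.ne_of_mem_erase hl)])
  have hr0 : row i₀ / g i₀ ≤ 0 := div_nonpos_of_nonneg_of_nonpos (hrow0 _) hg₀.le
  have hcard : ∑ _l ∈ Finset.univ.erase i₀, 2 * lam = 2 * lam * Fintype.card ι - 2 * lam := by
    have := hsum fun _ => 2 * lam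
    simp only [Finset.sum_const, Finset.card_univ, nsmul_eq_mul] at this ⊢
    linarith
  rw [hsum, h4, Finset.sum_sub_distrib, Finset.sum_add_distrib, hcard] at h3
  have hΓ' := hΓ
  rw [hsum] at hΓ'
  have hd : (0 : ℝ) ≤ Fintype.card ι := Nat.cast_nonneg _
  have hm : (0 : ℝ) ≤ Fintype.card μ := Nat.cast_nonneg _
  have hdl := mul_nonneg hlam hd
  have hml := mul_nonneg hlam hm
  have hlam0 : lam = 0 := by nlinarith
  subst hlam0
  have hr : row i₀ = 0 := by
    have : row i₀ / g i₀ = 0 := by linarith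
    simpa [hg₀.ne] using this
  have hS : ∑ l ∈ Finset.univ.erase i₀, rest l / (2 * g l) = 0 := by linarith
  have hre : ∀ l, l ≠ i₀ → rest l = 0 := fun l hl => by
    rw [Finset.sum_eq_zero_iff_of_nonneg] at hS
    · have := hS l (Finset.mem_erase.2 ⟨hl, Finset.mem_univ _⟩)
      simpa [(hgpos l hl).ne'] using this
    · intro l hl
      exact div_nonneg (hrest0 l) (by linarith [hgpos l (Finset.ne_of_mem_erase hl)])
  have hΓ0 : ∑ i, 1 / g i = 0 := by rw [hΓ]; simp
  refine ⟨rfl, ?_, hΓ0, fun i => by linarith [hR2 i], ?_, ?_, ?_⟩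
  · rw [hΓ0] at hR1
    have h0 : ∑ j, ∑ k, κ j k ^ 2 = 0 := by linarith
    intro j k
    rw [Finset.sum_eq_zero_iff_of_nonneg fun _ _ => by positivity] at h0
    have := h0 j (Finset.mem_univ _)
    rw [Finset.sum_eq_zero_iff_of_nonneg fun _ _ => by positivity] at this
    exact pow_eq_zero_iff two_ne_zero |>.1 (this k (Finset.mem_univ _))
  · intro k
    simp only [hrow] at hr
    rw [Finset.sum_eq_zero_iff_of_nonneg fun _ _ => by positivity] at hr
    exact pow_eq_zero_iff two_ne_zero |>.1 (hr k (Finset.mem_univ _))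
  · intro l hl
    have h5 := hsplit l
    have h6 := hre l hl
    simp only [hrow] at h5
    linarith
  · intro l hl j k hj hk
    have h0 := hre l hl
    simp only [hrest] at h0
    rw [Finset.sum_eq_zero_iff_of_nonneg fun _ _ => by positivity] at h0
    have := h0 j (Finset.mem_erase.2 ⟨hj, Finset.mem_univ _⟩)
    rw [Finset.sum_eq_zero_iff_of_nonneg fun _ _ => by positivity] at this
    exact pow_eq_zero_iff two_ne_zero |>.1 (this k (Finset.mem_erase.2 ⟨hk, Finset.mem_univ _⟩))

end StructureConstants

section StructureConstants
variable {ι μ : Type*} [Fintype ι] [Fintype μ] [DecidableEq ι] [DecidableEq μ] {i₀ : ι} {g : ι → ℝ}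
  {c : ι → ι ⊕ μ → ι ⊕ μ → ℝ}

theorem timelike_constants_eq (hg₀ : g i₀ < 0) (hgpos : ∀ i, i ≠ i₀ → 0 < g i)
    (hc : ∀ i j k, c i j k = -c i k j)
    (hcoc : ∀ p q r, ∑ i, (1 / g i) * ((if .inl i = r then c i p q else 0) +
      (if .inl i = p then c i q r else 0) + (if .inl i = q then c i r p else 0)) = 0)
    (hΓ : ∑ i, 1 / g i = 0) (hnorm : ∑ j, ∑ k, c i₀ j k ^ 2 = 2)
    (hc₀ : ∀ k, c i₀ (.inl i₀) k = 0)
    (hb : ∀ l, l ≠ i₀ → ∑ k, c l (.inl i₀) k ^ 2 = 1)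
    {l : ι} (hl : l ≠ i₀) :
    c l (.inl i₀) (.inl l) = 0 ∧ ∀ j k, j ≠ .inl i₀ → k ≠ .inl i₀ →
      c i₀ j k = (if .inl l = k then c l (.inl i₀) j else 0) -
        (if .inl l = j then c l (.inl i₀) k else 0) := by
  set M : ι → ι ⊕ μ → ι ⊕ μ → ℝ := fun l j k => (if .inl l = k then c l (.inl i₀) j else 0) -
        (if .inl l = j then c l (.inl i₀) k else 0) with hM
  set J : Finset (ι ⊕ μ) := Finset.univ.erase (.inl i₀) with hJ
  set L : Finset ι := Finset.univ.erase i₀ with hL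
  set p : ι → ℝ := fun l => -g i₀ / g l with hp
  have hmem : ∀ {l}, l ≠ i₀ → Sum.inl l ∈ J := fun h => by simpa [hJ] using h
  have hp0 : ∀ l, l ≠ i₀ → 0 < p l := fun l hl => div_pos (by linarith) (hgpos l hl)
  have hp1 : ∑ l ∈ L, p l = 1 := by
    have h1 : ∑ l, p l = 0 := by
      simp only [hp, div_eq_mul_one_div (-g i₀), ← Finset.mul_sum, hΓ, mul_zero]
    rw [← Finset.add_sum_erase _ _ (Finset.mem_univ i₀)] at h1
    have h2 : p i₀ = -1 := by simp only [hp]; field_simp [hg₀.ne]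
    linarith
  have hcM : ∀ j k, j ≠ .inl i₀ → k ≠ .inl i₀ → c i₀ j k = ∑ l ∈ L, p l * M l j k := by
    intro j k hj hk
    have h1 := hcoc (.inl i₀) j k
    rw [← Finset.add_sum_erase _ _ (Finset.mem_univ i₀)] at h1
    simp only [hj.symm, hk.symm, if_true, if_false, zero_add, add_zero] at h1
    have h2 : ∑ l ∈ L, p l * M l j k = -g i₀ * ∑ i ∈ Finset.univ.erase i₀, (1 / g i) *
        ((if .inl i = k then c i (.inl i₀) j else 0) +
          (if (Sum.inl i : ι ⊕ μ) = Sum.inl i₀ then c i j k else 0) +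
          (if .inl i = j then c i k (.inl i₀) else 0)) := by
      rw [Finset.mul_sum]
      refine Finset.sum_congr rfl fun l hl => ?_
      have hne : (Sum.inl l : ι ⊕ μ) ≠ Sum.inl i₀ := by simpa using Finset.ne_of_mem_erase hl
      simp only [hp, hM, hne, if_false, hc l k (.inl i₀)]
      split_ifs <;> ring
    rw [h2]
    have h3 : g i₀ * (1 / g i₀) = 1 := mul_one_div_cancel hg₀.ne
    linear_combination g i₀ * h1 - c i₀ j k * h3
  have hb' : ∀ l, l ≠ i₀ → ∑ k ∈ J, c l (.inl i₀) k ^ 2 = 1 := fun l hl => by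
    rw [← hb l hl, ← Finset.add_sum_erase _ _ (Finset.mem_univ (Sum.inl i₀))]
    have : c l (.inl i₀) (.inl i₀) = 0 := by linarith [hc l (.inl i₀) (.inl i₀)]
    rw [this]; simp [hJ]
  have hMn : ∀ l, l ≠ i₀ → ∑ j ∈ J, ∑ k ∈ J, M l j k ^ 2 = 2 - 2 * c l (.inl i₀) (.inl l) ^ 2 := by
    intro l hl
    have h1 : ∀ j k, M l j k ^ 2 = (if .inl l = k then c l (.inl i₀) j ^ 2 else 0) +
        (if .inl l = j then c l (.inl i₀) k ^ 2 else 0) -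
        2 * (if .inl l = k then (if .inl l = j then c l (.inl i₀) (.inl l) ^ 2 else 0) else 0) := by
      intro j k
      simp only [hM]
      split_ifs with h1 h2 h2
      · subst h1; subst h2; ring
      all_goals ring
    simp only [h1, Finset.sum_sub_distrib, Finset.sum_add_distrib, ← Finset.mul_sum,
      Finset.sum_ite_eq, hmem hl, if_true]
    have h2 : ∑ j ∈ J, ∑ k ∈ J, (if .inl l = j then c l (.inl i₀) k ^ 2 else 0) = 1 := by
      rw [Finset.sum_comm]
      simp only [Finset.sum_ite_eq, hmem hl, if_true, hb' l hl]
    rw [h2, hb' l hl]; ring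
  have hnorm' : ∑ j ∈ J, ∑ k ∈ J, c i₀ j k ^ 2 = 2 := by
    have := two_mul_row_le (hc i₀) (.inl i₀)
    simp only [hc₀, hnorm, zero_pow two_ne_zero, Finset.sum_const_zero, mul_zero, zero_add] at this
    exact this
  have hvar : ∑ l ∈ L, p l * ((∑ j ∈ J, ∑ k ∈ J, (M l j k - c i₀ j k) ^ 2) +
      2 * c l (.inl i₀) (.inl l) ^ 2) = 0 := by
    have h1 : ∀ l ∈ L, p l * ((∑ j ∈ J, ∑ k ∈ J, (M l j k - c i₀ j k) ^ 2) +
        2 * c l (.inl i₀) (.inl l) ^ 2) =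
        4 * p l - 2 * ∑ j ∈ J, ∑ k ∈ J, c i₀ j k * (p l * M l j k) := by
      intro l hl
      have h2 : ∑ j ∈ J, ∑ k ∈ J, (M l j k - c i₀ j k) ^ 2 = ∑ j ∈ J, ∑ k ∈ J, M l j k ^ 2 -
          2 * ∑ j ∈ J, ∑ k ∈ J, c i₀ j k * M l j k + ∑ j ∈ J, ∑ k ∈ J, c i₀ j k ^ 2 := by
        simp only [Finset.mul_sum, ← Finset.sum_sub_distrib, ← Finset.sum_add_distrib]
        exact Finset.sum_congr rfl fun j _ => Finset.sum_congr rfl fun k _ => by ring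
      have h3 : ∑ j ∈ J, ∑ k ∈ J, c i₀ j k * (p l * M l j k) =
          p l * ∑ j ∈ J, ∑ k ∈ J, c i₀ j k * M l j k := by
        simp only [Finset.mul_sum]
        exact Finset.sum_congr rfl fun j _ => Finset.sum_congr rfl fun k _ => by ring
      rw [h2, h3, hMn l (Finset.ne_of_mem_erase hl), hnorm']; ring
    have h4 : ∑ l ∈ L, ∑ j ∈ J, ∑ k ∈ J, c i₀ j k * (p l * M l j k) =
        ∑ j ∈ J, ∑ k ∈ J, c i₀ j k ^ 2 := by
      rw [Finset.sum_comm]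
      refine Finset.sum_congr rfl fun j hj => ?_
      rw [Finset.sum_comm]
      refine Finset.sum_congr rfl fun k hk => ?_
      rw [← Finset.mul_sum, ← hcM j k (Finset.ne_of_mem_erase hj) (Finset.ne_of_mem_erase hk)]
      ring
    rw [Finset.sum_congr rfl h1, Finset.sum_sub_distrib, ← Finset.mul_sum, ← Finset.mul_sum, hp1,
      h4, hnorm']
    ring
  have hsq : ∀ l, 0 ≤ ∑ j ∈ J, ∑ k ∈ J, (M l j k - c i₀ j k) ^ 2 := fun l => by positivity
  rw [Finset.sum_eq_zero_iff_of_nonneg fun l hl => mul_nonneg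
    (hp0 l (Finset.ne_of_mem_erase hl)).le (add_nonneg (hsq l) (by positivity))] at hvar
  have h1 := (mul_eq_zero.1 (hvar l (Finset.mem_erase.2 ⟨hl, Finset.mem_univ _⟩))).resolve_left
    (hp0 l hl).ne'
  have h2 : 0 ≤ c l (.inl i₀) (.inl l) ^ 2 := sq_nonneg _
  refine ⟨pow_eq_zero_iff two_ne_zero |>.1 (by linarith [hsq l]), fun j k hj hk => ?_⟩
  have h3 : ∑ j ∈ J, ∑ k ∈ J, (M l j k - c i₀ j k) ^ 2 = 0 := by linarith [hsq l]
  rw [Finset.sum_eq_zero_iff_of_nonneg fun _ _ => by positivity] at h3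
  have h4 := h3 j (Finset.mem_erase.2 ⟨hj, Finset.mem_univ _⟩)
  rw [Finset.sum_eq_zero_iff_of_nonneg fun _ _ => by positivity] at h4
  have := pow_eq_zero_iff two_ne_zero |>.1 (h4 k (Finset.mem_erase.2 ⟨hk, Finset.mem_univ _⟩))
  exact (sub_eq_zero.1 this).symm

end StructureConstants

/-- An orthogonal frame `(z, u, e)` adapted to the bracket: `z` and `u` span the derived algebra,
and `e` is an orthonormal basis of its orthogonal complement. -/
structure IsAdaptedFrame {H : Type*} [LieRing H] [LieAlgebra ℝ H] (B : H →ₗ[ℝ] H →ₗ[ℝ] ℝ) (z : H)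
    {d m : ℕ} (g : Fin d → ℝ) (u : Fin d → H) (e : Fin d ⊕ Fin m → H)
    (f : Basis ((Unit ⊕ Fin d) ⊕ (Fin d ⊕ Fin m)) ℝ H) : Prop where
  basis_center : f (.inl (.inl ())) = z
  basis_u : ∀ i, f (.inl (.inr i)) = u i
  basis_e : ∀ j, f (.inr j) = e j
  ne_zero : ∀ i, Sum.elim (Sum.elim (fun _ : Unit => 1) g) (fun _ : Fin d ⊕ Fin m => (1 : ℝ)) i ≠ 0
  ortho : ∀ i j, B (f i) (f j) = if i = j then
    Sum.elim (Sum.elim (fun _ : Unit => 1) g) (fun _ : Fin d ⊕ Fin m => (1 : ℝ)) i else 0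
  lie_u : ∀ i w, ⁅u i, w⁆ = B (e (.inl i)) w • z
  e_lie : ∀ j, ∀ a b : H, B (e j) ⁅a, b⁆ = 0

namespace ThreeStepEinstein
variable {H : Type*} [LieRing H] [LieAlgebra ℝ H]
  {B : H →ₗ[ℝ] H →ₗ[ℝ] ℝ} {z : H} {lam : ℝ}

theorem exists_adaptedFrame [FiniteDimensional ℝ H] (h : ThreeStepEinstein B z lam)
    (hz : B z z = 1) (hnd : ∀ u : H, (∀ v : H, B u v = 0) → u = 0)
    (K : H →ₗ[ℝ] H) (hK : ∀ v w, B (K v) w = B z ⁅v, w⁆) :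
    ∃ (d m : ℕ) (g : Fin d → ℝ) (u : Fin d → H) (e : Fin d ⊕ Fin m → H)
      (f : Basis ((Unit ⊕ Fin d) ⊕ (Fin d ⊕ Fin m)) ℝ H), IsAdaptedFrame B z g u e f := by
  have hpos : ∀ {e : H}, (∀ a b : H, B e ⁅a, b⁆ = 0) → e ≠ 0 → 0 < B e e :=
    fun he he0 => h.pos_of_orthogonal_lie hz hnd K hK he he0
  have hzmem : z ∈ bracketSpan H := by
    obtain ⟨a, b, c, habc⟩ := h.exists_lie_lie_ne_zero
    obtain ⟨s, hs⟩ := h.lie_lie_eq_smul a b c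
    have hs0 : s ≠ 0 := by rintro rfl; exact habc (by rw [hs, zero_smul])
    have : z = s⁻¹ • ⁅a, ⁅b, c⁆⁆ := by rw [hs, smul_smul, inv_mul_cancel₀ hs0, one_smul]
    rw [this]
    exact Submodule.smul_mem _ _ (lie_mem_bracketSpan _ _)
  set D : Submodule ℝ H := bracketSpan H ⊓ LinearMap.ker (B z) with hD
  have hKE : ∀ {x : H}, x ∈ bracketSpan H → ∀ a b : H, B (K x) ⁅a, b⁆ = 0 := fun hx a b => by
    rw [hK, h.lie_mem_bracketSpan_eq_zero hx (lie_mem_bracketSpan a b), map_zero]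
  obtain ⟨d, u', hu'q, hu'g⟩ : ∃ (d : ℕ) (u' : Basis (Fin d) ℝ D),
      (∀ i j, B (K (u' i)) (K (u' j)) = if i = j then 1 else 0) ∧
      ∀ i j, i ≠ j → B (u' i : H) (u' j) = 0 := ⟨_, exists_simultaneous_basis (V := D)
    (B.compl₁₂ (K ∘ₗ D.subtype) (K ∘ₗ D.subtype)) (B.compl₁₂ D.subtype D.subtype)
    (fun _ _ => h.symm _ _) (fun x hx => hpos (hKE x.2.1) (by
      intro h0
      obtain ⟨s, hs⟩ := h.eq_smul_of_central (x : H) fun w => by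
        have h0' : K (x : H) = 0 := h0
        rw [← lie_skew, h.lie_eq_smul_of_mem hz x.2.1 w, ← hK, h0']; simp
      have h1 : B z x = 0 := x.2.2
      rw [hs] at h1
      have : s = 0 := by simpa [hz] using h1
      exact hx (Subtype.ext (by rw [hs, this, zero_smul]; rfl)))) fun _ _ => h.symm _ _⟩
  set u : Fin d → H := fun i => u' i with hu
  set x : Fin d → H := fun i => K (u i) with hx
  set g : Fin d → ℝ := fun i => B (u i) (u i) with hg
  have hbr : ∀ v, B z v = 0 → (∀ i, B (u i) v = 0) → ∀ a b : H, B v ⁅a, b⁆ = 0 := by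
    intro v hzv huv a b
    have hmem : ⁅a, b⁆ - B z ⁅a, b⁆ • z ∈ D :=
      ⟨Submodule.sub_mem _ (lie_mem_bracketSpan a b) (Submodule.smul_mem _ _ hzmem), by simp [hz]⟩
    have h1 : B v ∘ₗ D.subtype = 0 := u'.ext fun i => by
      change B v (u i) = 0
      rw [h.symm, huv]
    have h2 : B v (⁅a, b⁆ - B z ⁅a, b⁆ • z) = 0 := congrArg (fun f => f ⟨_, hmem⟩) h1
    simpa [h.symm v z, hzv] using h2
  have huu : ∀ i j, B (u i) (u j) = if i = j then g i else 0 := fun i j => by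
    split_ifs with hij
    · rw [hij]
    · exact hu'g i j hij
  have hzu : ∀ i, B z (u i) = 0 := fun i => (u' i).2.2
  have hg0 : ∀ i, g i ≠ 0 := fun i h0 => by
    refine (hpos (hbr (u i) (hzu i) fun j => ?_) ?_).ne' h0
    · rw [huu]; split_ifs with hij
      · rw [hij, h0]
      · rfl
    · intro h1
      exact u'.ne_zero i (Subtype.ext h1)
  have hxE : ∀ i, ∀ a b : H, B (x i) ⁅a, b⁆ = 0 := fun i => hKE (u' i).2.1
  have hEmem : ∀ v : H, (∀ a b : H, B v ⁅a, b⁆ = 0) → ∀ w ∈ bracketSpan H, B v w = 0 :=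
    fun v hv w hw => eq_zero_of_mem_bracketSpan (B v) hv hw
  have hxx : ∀ i j, B (x i) (x j) = if i = j then 1 else 0 := fun i j => hu'q i j
  obtain ⟨m, y, hvy, hyy, hy⟩ := exists_orthonormal_complement h.symm
    (Sum.elim (Sum.elim (fun _ : Unit => z) u) x)
    fun v hv => hpos (hbr v (hv (.inl (.inl ()))) fun i => hv (.inl (.inr i)))
  have hyE : ∀ j, ∀ a b : H, B (y j) ⁅a, b⁆ = 0 := fun j =>
    hbr (y j) (hvy (.inl (.inl ())) j) fun i => hvy (.inl (.inr i)) j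
  have hG : ∀ i, Sum.elim (Sum.elim (fun _ : Unit => 1) g)
      (fun _ : Fin d ⊕ Fin m => (1 : ℝ)) i ≠ 0 := by
    rintro ((i | i) | i)
    · exact one_ne_zero
    · exact hg0 i
    · exact one_ne_zero
  have heE : ∀ j, ∀ a b : H, B (Sum.elim x y j) ⁅a, b⁆ = 0 := by
    rintro (j | j)
    · exact hxE j
    · exact hyE j
  have hee : ∀ i j, B (Sum.elim x y i) (Sum.elim x y j) = if i = j then 1 else 0 := by
    rintro (i | i) (j | j)
    · simp [hxx]
    · simpa using hvy (.inr i) j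
    · rw [h.symm]; simpa using hvy (.inr j) i
    · simp [hyy]
  have hez : ∀ i, B (Sum.elim x y i) z = 0 := fun i => hEmem _ (heE i) _ hzmem
  have heu : ∀ i k, B (Sum.elim x y i) (u k) = 0 := fun i k => hEmem _ (heE i) _ (u' k).2.1
  have ho : ∀ i j, B (Sum.elim (Sum.elim (fun _ : Unit => z) u) (Sum.elim x y) i)
      (Sum.elim (Sum.elim (fun _ : Unit => z) u) (Sum.elim x y) j) =
      if i = j then Sum.elim (Sum.elim (fun _ : Unit => 1) g)
        (fun _ : Fin d ⊕ Fin m => (1 : ℝ)) i else 0 := by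
    rintro ((i | i) | i) ((j | j) | j)
    · simp [hz]
    · simp [hzu]
    · rw [h.symm]; simpa using hez j
    · rw [h.symm]; simpa using hzu i
    · simp [huu]
    · rw [h.symm]; simpa using heu j i
    · simpa using hez i
    · simpa using heu i j
    · simpa using hee i j
  obtain ⟨f, hf⟩ := exists_orthogonal_basis _ _ ho hG fun v hv => hy v (by
    rintro (i | i)
    · exact hv (.inl i)
    · exact hv (.inr (.inl i))) fun j => hv (.inr (.inr j))
  refine ⟨d, m, g, u, Sum.elim x y, f, hf _, fun i => hf _, fun j => hf _, hG, fun i j => ?_,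
    fun i w => ?_, heE⟩
  · rw [hf, hf, ho]
  · rw [h.lie_eq_smul_of_mem hz (u' i).2.1 w, ← hK]; rfl

end ThreeStepEinstein

namespace IsAdaptedFrame
variable {H : Type*} [LieRing H] [LieAlgebra ℝ H]
  {B : H →ₗ[ℝ] H →ₗ[ℝ] ℝ} {z : H} {lam : ℝ} {d m : ℕ} {g : Fin d → ℝ} {u : Fin d → H}
  {e : Fin d ⊕ Fin m → H} {f : Basis ((Unit ⊕ Fin d) ⊕ (Fin d ⊕ Fin m)) ℝ H}

theorem center_center (hf : IsAdaptedFrame B z g u e f) : B z z = 1 := by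
  simpa [hf.basis_center] using hf.ortho (.inl (.inl ())) (.inl (.inl ()))

theorem center_u (hf : IsAdaptedFrame B z g u e f) (i : Fin d) : B z (u i) = 0 := by
  simpa [hf.basis_center, hf.basis_u] using hf.ortho (.inl (.inl ())) (.inl (.inr i))

theorem u_center (hf : IsAdaptedFrame B z g u e f) (i : Fin d) : B (u i) z = 0 := by
  simpa [hf.basis_center, hf.basis_u] using hf.ortho (.inl (.inr i)) (.inl (.inl ()))

theorem e_center (hf : IsAdaptedFrame B z g u e f) (i : Fin d ⊕ Fin m) : B (e i) z = 0 := by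
  simpa [hf.basis_center, hf.basis_e] using hf.ortho (.inr i) (.inl (.inl ()))

theorem center_e (hf : IsAdaptedFrame B z g u e f) (i : Fin d ⊕ Fin m) : B z (e i) = 0 := by
  simpa [hf.basis_center, hf.basis_e] using hf.ortho (.inl (.inl ())) (.inr i)

theorem u_u (hf : IsAdaptedFrame B z g u e f) (i j : Fin d) :
    B (u i) (u j) = if i = j then g i else 0 := by
  simpa [hf.basis_u] using hf.ortho (.inl (.inr i)) (.inl (.inr j))

theorem u_e (hf : IsAdaptedFrame B z g u e f) (i : Fin d) (j : Fin d ⊕ Fin m) :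
    B (u i) (e j) = 0 := by
  simpa [hf.basis_u, hf.basis_e] using hf.ortho (.inl (.inr i)) (.inr j)

theorem e_u (hf : IsAdaptedFrame B z g u e f) (i : Fin d) (j : Fin d ⊕ Fin m) :
    B (e j) (u i) = 0 := by
  simpa [hf.basis_u, hf.basis_e] using hf.ortho (.inr j) (.inl (.inr i))

theorem e_e (hf : IsAdaptedFrame B z g u e f) (i j : Fin d ⊕ Fin m) :
    B (e i) (e j) = if i = j then 1 else 0 := by
  simpa [hf.basis_e] using hf.ortho (.inr i) (.inr j)

theorem u_ne_zero (hf : IsAdaptedFrame B z g u e f) (i : Fin d) : g i ≠ 0 :=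
  hf.ne_zero (.inl (.inr i))

theorem lie_u_e (hf : IsAdaptedFrame B z g u e f) (i : Fin d) (j : Fin d ⊕ Fin m) :
    ⁅u i, e j⁆ = if .inl i = j then z else 0 := by
  rw [hf.lie_u, hf.e_e, ite_smul, one_smul, zero_smul]

theorem lie_e_u (hf : IsAdaptedFrame B z g u e f) (i : Fin d) (j : Fin d ⊕ Fin m) :
    ⁅e j, u i⁆ = if .inl i = j then -z else 0 := by
  rw [← lie_skew, hf.lie_u_e]; split_ifs <;> simp

theorem lie_u_u (hf : IsAdaptedFrame B z g u e f) (i j : Fin d) : ⁅u i, u j⁆ = 0 := by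
  rw [hf.lie_u, hf.e_u, zero_smul]

theorem lie_e_e (hf : IsAdaptedFrame B z g u e f) (j k : Fin d ⊕ Fin m) :
    ⁅e j, e k⁆ = B z ⁅e j, e k⁆ • z + ∑ i, (B (u i) ⁅e j, e k⁆ / g i) • u i := by
  conv_lhs => rw [← f.sum_repr ⁅e j, e k⁆]
  simp only [repr_eq_div hf.ortho hf.ne_zero, Fintype.sum_sum_type, hf.basis_center, hf.basis_u,
    hf.basis_e, hf.e_lie]
  simp

theorem bilin_lie_e_e (hf : IsAdaptedFrame B z g u e f) (hB : ∀ u v, B u v = B v u)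
    (j k l n : Fin d ⊕ Fin m) :
    B ⁅e j, e k⁆ ⁅e l, e n⁆ = B z ⁅e j, e k⁆ * B z ⁅e l, e n⁆ +
      ∑ i, B (u i) ⁅e j, e k⁆ * B (u i) ⁅e l, e n⁆ / g i := by
  rw [parseval hf.ortho hf.ne_zero hB]
  simp only [hB ⁅_, _⁆ (f _)]
  simp [Fintype.sum_sum_type, hf.basis_center, hf.basis_u, hf.basis_e, hf.e_lie]


theorem center_lie_u_e (hf : IsAdaptedFrame B z g u e f) (i : Fin d) (j : Fin d ⊕ Fin m) :
    B z ⁅u i, e j⁆ = if .inl i = j then 1 else 0 := by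
  rw [hf.lie_u_e, apply_ite (B z), hf.center_center, map_zero]

theorem center_lie_e_u (hf : IsAdaptedFrame B z g u e f) (i : Fin d) (j : Fin d ⊕ Fin m) :
    B z ⁅e j, u i⁆ = -if .inl i = j then 1 else 0 := by
  rw [← lie_skew, map_neg, hf.center_lie_u_e]

theorem ricci_center (hf : IsAdaptedFrame B z g u e f) (h : ThreeStepEinstein B z lam) :
    4 * lam = 2 * ∑ i, 1 / g i + ∑ j, ∑ k, B z ⁅e j, e k⁆ ^ 2 := by
  have := h.einstein f _ hf.ortho hf.ne_zero z z
  have hite : ∀ i j, B z ⁅e j, u i⁆ * B z ⁅e j, u i⁆ = if .inl i = j then 1 else 0 := fun i j => by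
    rw [hf.center_lie_e_u]; split_ifs <;> simp
  simp [ricciSum, hf.basis_center, hf.basis_u, hf.basis_e, h.center_lie, h.lie_center,
    hf.center_center, hf.center_lie_u_e, hite, hf.lie_u_u, Finset.sum_add_distrib, ite_div] at this
  simp [Finset.sum_add_distrib, pow_two]
  linarith

theorem ricci_u (hf : IsAdaptedFrame B z g u e f) (h : ThreeStepEinstein B z lam) (i : Fin d) :
    4 * lam * g i = -2 + ∑ j, ∑ k, B (u i) ⁅e j, e k⁆ ^ 2 := by
  have := h.einstein f _ hf.ortho hf.ne_zero (u i) (u i)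
  have hite : ∀ j : Fin d ⊕ Fin m, B ⁅u i, e j⁆ ⁅u i, e j⁆ = if .inl i = j then 1 else 0 :=
    fun j => by rw [hf.lie_u_e]; split_ifs <;> simp [hf.center_center]
  have hu1 : ∀ j k, B (u i) ⁅u j, e k⁆ = 0 := fun j k => by
    rw [hf.lie_u_e]; split_ifs <;> simp [hf.u_center]
  have hu2 : ∀ j k, B (u i) ⁅e k, u j⁆ = 0 := fun j k => by
    rw [hf.lie_e_u]; split_ifs <;> simp [hf.u_center]
  simp [ricciSum, hf.basis_center, hf.basis_u, hf.basis_e, h.center_lie, h.lie_center, hite,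
    hu1, hu2, hf.lie_u_u, hf.u_u, Finset.sum_add_distrib] at this
  simp [Finset.sum_add_distrib, pow_two]
  linarith

theorem center_lie_inl (hf : IsAdaptedFrame B z g u e f) (h : ThreeStepEinstein B z lam)
    (i : Fin d) (j : Fin d ⊕ Fin m) : B z ⁅e (.inl i), e j⁆ = 0 := by
  have := h.einstein f _ hf.ortho hf.ne_zero (u i) (e j)
  have hite : ∀ k : Fin d ⊕ Fin m, ∀ v, B ⁅u i, e k⁆ v = if .inl i = k then B z v else 0 :=
    fun k v => by rw [hf.lie_u_e]; split_ifs <;> simp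
  simp [ricciSum, hf.basis_center, hf.basis_u, hf.basis_e, h.lie_center, hite, hf.lie_u_u,
    hf.u_e, hf.e_lie] at this
  rw [← lie_skew, map_neg, this, neg_zero]

theorem ricci_e (hf : IsAdaptedFrame B z g u e f) (h : ThreeStepEinstein B z lam)
    (j : Fin d ⊕ Fin m) : -2 * lam = (∑ i, if .inl i = j then 1 / g i else 0) +
      (∑ k, ∑ l, B (u l) ⁅e j, e k⁆ ^ 2 / g l) + ∑ k, B z ⁅e j, e k⁆ ^ 2 := by
  have := h.einstein f _ hf.ortho hf.ne_zero (e j) (e j)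
  have hite : ∀ i, B ⁅e j, u i⁆ ⁅e j, u i⁆ = if .inl i = j then 1 else 0 :=
    fun j => by rw [hf.lie_e_u]; split_ifs <;> simp [hf.center_center]
  simp [ricciSum, hf.basis_center, hf.basis_u, hf.basis_e, h.lie_center, hite, hf.e_lie, hf.e_e,
    hf.bilin_lie_e_e h.symm, ite_div, Finset.sum_add_distrib] at this
  simp [pow_two]
  linarith

theorem cocycle (hf : IsAdaptedFrame B z g u e f) (h : ThreeStepEinstein B z lam)
    (p q r : Fin d ⊕ Fin m) :
    ∑ i, (1 / g i) * ((if .inl i = r then B (u i) ⁅e p, e q⁆ else 0) +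
      (if .inl i = p then B (u i) ⁅e q, e r⁆ else 0) +
      (if .inl i = q then B (u i) ⁅e r, e p⁆ else 0)) = 0 := by
  have key : ∀ p q r, B z ⁅e r, ⁅e p, e q⁆⁆ =
      -∑ i, (1 / g i) * (if .inl i = r then B (u i) ⁅e p, e q⁆ else 0) := fun p q r => by
    conv_lhs => rw [hf.lie_e_e p q]
    simp only [lie_add, lie_smul, h.lie_center, lie_sum, map_sum, map_smul,
      hf.center_lie_e_u, smul_eq_mul, smul_zero, zero_add, ← Finset.sum_neg_distrib]
    refine Finset.sum_congr rfl fun i _ => ?_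
    split_ifs <;> ring
  have := congrArg (B z) (lie_jacobi (e p) (e q) (e r))
  simp only [map_add, key, map_zero] at this
  simp only [mul_add, Finset.sum_add_distrib]
  linarith

theorem exists_neg (hf : IsAdaptedFrame B z g u e f) (h : ThreeStepEinstein B z lam) :
    ∃ i₀, g i₀ < 0 ∧ ∀ i, i ≠ i₀ → 0 < g i := by
  have : ∃ i₀, g i₀ < 0 := by
    by_contra! hg
    obtain ⟨t, ht⟩ := h.exists_timelike
    rw [parseval hf.ortho hf.ne_zero h.symm] at ht
    refine ht.not_ge (Finset.sum_nonneg ?_)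
    rintro ((i | i) | i) -
    · simpa using mul_self_nonneg _
    · exact div_nonneg (mul_self_nonneg _) (hg i)
    · simpa using mul_self_nonneg _
  obtain ⟨i₀, hi₀⟩ := this
  refine ⟨i₀, hi₀, fun i hi => ?_⟩
  have := h.pos_of_orthogonal (u i₀) (u i) (by simpa [hf.u_u] using hi₀)
    (by simp [hf.u_u, hi.symm]) fun h0 => hf.u_ne_zero i (by simpa [h0] using (hf.u_u i i).symm)
  simpa [hf.u_u] using this

variable {i₀ : Fin d}

theorem lie_e_swap (w : H) (j k : Fin d ⊕ Fin m) : B w ⁅e j, e k⁆ = -B w ⁅e k, e j⁆ := by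
  rw [← lie_skew, map_neg]

theorem flat (hf : IsAdaptedFrame B z g u e f) (h : ThreeStepEinstein B z lam)
    (hg₀ : g i₀ < 0) (hgpos : ∀ i, i ≠ i₀ → 0 < g i) :
    lam = 0 ∧ (∀ j k, B z ⁅e j, e k⁆ = 0) ∧ ∑ i, 1 / g i = 0 ∧
      (∀ i, ∑ j, ∑ k, B (u i) ⁅e j, e k⁆ ^ 2 = 2) ∧
      (∀ k, B (u i₀) ⁅e (.inl i₀), e k⁆ = 0) ∧
      (∀ l, l ≠ i₀ → ∑ k, B (u l) ⁅e (.inl i₀), e k⁆ ^ 2 = 1) ∧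
      ∀ l, l ≠ i₀ → ∀ j k, j ≠ .inl i₀ → k ≠ .inl i₀ → B (u l) ⁅e j, e k⁆ = 0 :=
  einstein_flat (c := fun i j k => B (u i) ⁅e j, e k⁆) (κ := fun j k => B z ⁅e j, e k⁆)
    hg₀ hgpos (fun _ _ _ => lie_e_swap _ _ _) (hf.center_lie_inl h) (hf.ricci_center h)
    (hf.ricci_u h) (fun i => by simpa using hf.ricci_e h (.inl i))
    fun y => by simpa using hf.ricci_e h (.inr y)

theorem timelike_lie (hf : IsAdaptedFrame B z g u e f) (h : ThreeStepEinstein B z lam)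
    (hg₀ : g i₀ < 0) (hgpos : ∀ i, i ≠ i₀ → 0 < g i) {l : Fin d} (hl : l ≠ i₀) :
    B (u l) ⁅e (.inl i₀), e (.inl l)⁆ = 0 ∧ ∀ j k, j ≠ .inl i₀ → k ≠ .inl i₀ →
      B (u i₀) ⁅e j, e k⁆ = (if .inl l = k then B (u l) ⁅e (.inl i₀), e j⁆ else 0) -
        (if .inl l = j then B (u l) ⁅e (.inl i₀), e k⁆ else 0) := by
  obtain ⟨-, -, hΓ, hnorm, hc₀, hb, -⟩ := hf.flat h hg₀ hgpos
  exact timelike_constants_eq (c := fun i j k => B (u i) ⁅e j, e k⁆) hg₀ hgpos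
    (fun _ _ _ => lie_e_swap _ _ _) (hf.cocycle h) hΓ (hnorm i₀) hc₀ hb hl

theorem eq_zero_of_orthogonal (hf : IsAdaptedFrame B z g u e f) {v : H} (hz : B z v = 0)
    (hu : ∀ i, B (u i) v = 0) (he : ∀ j, B (e j) v = 0) : v = 0 := by
  rw [← f.sum_repr v]
  simp [repr_eq_div hf.ortho hf.ne_zero, -Basis.sum_repr, hf.basis_center, hf.basis_u, hf.basis_e,
    hz, hu, he]

/-- A vector orthogonal to the center cannot commute with every `u i` and every `e j`. -/
theorem eq_zero_of_commute (hf : IsAdaptedFrame B z g u e f) (h : ThreeStepEinstein B z lam)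
    {v : H} (hz : B z v = 0) (hu : ∀ i, ⁅v, u i⁆ = 0) (he : ∀ j, ⁅v, e j⁆ = 0) : v = 0 := by
  obtain ⟨s, hs⟩ := h.eq_smul_of_central v <| ThreeStepEinstein.lie_basis_eq_zero f <| by
    rintro ((i | i) | i)
    · rw [hf.basis_center, h.lie_center]
    · rw [hf.basis_u, hu]
    · rw [hf.basis_e, he]
  have : s = 0 := by simpa [hs, hf.center_center] using hz
  rw [hs, this, zero_smul]

theorem exists_ne (hf : IsAdaptedFrame B z g u e f) (h : ThreeStepEinstein B z lam)
    (hg₀ : g i₀ < 0) (hgpos : ∀ i, i ≠ i₀ → 0 < g i) : ∃ l, l ≠ i₀ := by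
  by_contra! hall
  obtain ⟨-, -, hΓ, -⟩ := hf.flat h hg₀ hgpos
  rw [Fintype.sum_eq_single i₀ fun i hi => absurd (hall i) hi] at hΓ
  simp [hg₀.ne] at hΓ

theorem eq_of_ne_of_ne (hf : IsAdaptedFrame B z g u e f) (h : ThreeStepEinstein B z lam)
    (hg₀ : g i₀ < 0) (hgpos : ∀ i, i ≠ i₀ → 0 < g i) {l l' : Fin d} (hl : l ≠ i₀) (hl' : l' ≠ i₀)
    (hll' : l ≠ l') (i : Fin d) : i = i₀ ∨ i = l ∨ i = l' := by
  by_contra! hi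
  obtain ⟨-, -, -, hnorm, hc₀, -⟩ := hf.flat h hg₀ hgpos
  have hzero : ∀ j k, B (u i₀) ⁅e j, e k⁆ = 0 := by
    intro j k
    by_cases hj : j = .inl i₀
    · rw [hj, hc₀]
    by_cases hk : k = .inl i₀
    · rw [lie_e_swap, hk, hc₀, neg_zero]
    have h1 := (hf.timelike_lie h hg₀ hgpos hl).2 j k hj hk
    have h2 := (hf.timelike_lie h hg₀ hgpos hl').2 j k hj hk
    have h3 := (hf.timelike_lie h hg₀ hgpos hi.1).2 j k hj hk
    rcases j with j | j <;> rcases k with k | k <;>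
      simp only [Sum.inl.injEq, reduceCtorEq, if_false, sub_zero, zero_sub] at h1 h2 h3 <;>
    grind
  have := hnorm i₀
  simp [hzero] at this

theorem isEmpty_of_ne_of_ne (hf : IsAdaptedFrame B z g u e f) (h : ThreeStepEinstein B z lam)
    (hg₀ : g i₀ < 0) (hgpos : ∀ i, i ≠ i₀ → 0 < g i) {l l' : Fin d} (hl : l ≠ i₀) (hl' : l' ≠ i₀)
    (hll' : l ≠ l') : IsEmpty (Fin m) := by
  refine ⟨fun y => ?_⟩
  obtain ⟨-, hκ, -, -, hc₀, -, hrest⟩ := hf.flat h hg₀ hgpos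
  have hy₀ : ∀ k, B (u i₀) ⁅e (.inr y), e k⁆ = 0 := by
    intro k
    by_cases hk : k = .inl i₀
    · rw [lie_e_swap, hk, hc₀, neg_zero]
    have h1 := (hf.timelike_lie h hg₀ hgpos hl).2 (.inr y) k Sum.inr_ne_inl hk
    have h2 := (hf.timelike_lie h hg₀ hgpos hl').2 (.inr y) k Sum.inr_ne_inl hk
    simp only [reduceCtorEq, if_false, sub_zero] at h1 h2
    grind
  have hb : ∀ l, l ≠ i₀ → B (u l) ⁅e (.inl i₀), e (.inr y)⁆ = 0 := by
    intro l hl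
    have := (hf.timelike_lie h hg₀ hgpos hl).2 (.inr y) (.inl l) Sum.inr_ne_inl (by simpa using hl)
    simpa [hy₀] using this.symm
  have hy : ∀ i k, B (u i) ⁅e (.inr y), e k⁆ = 0 := by
    intro i k
    by_cases hi : i = i₀
    · rw [hi, hy₀]
    by_cases hk : k = .inl i₀
    · rw [lie_e_swap, hk, hb i hi, neg_zero]
    · exact hrest i hi _ _ Sum.inr_ne_inl hk
  have h0 := hf.eq_zero_of_commute h (hf.center_e (.inr y)) (fun i => by simp [hf.lie_e_u])
    fun k => by rw [hf.lie_e_e]; simp [hκ, hy]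
  simpa [h0] using hf.e_e (.inr y) (.inr y)

theorem exists_basis_seven (hf : IsAdaptedFrame B z g u e f) (h : ThreeStepEinstein B z lam)
    (hg₀ : g i₀ < 0) (hgpos : ∀ i, i ≠ i₀ → 0 < g i) {l l' : Fin d} (hl : l ≠ i₀) (hl' : l' ≠ i₀)
    (hll' : l ≠ l') :
    ∃ (b : Basis (Fin 7) ℝ H) (r a : ℝ), 0 < r ∧ r < 1 ∧ 0 < a ∧
      ⁅b 0, b 1⁆ = b 4 ∧ ⁅b 0, b 2⁆ = b 5 ∧ ⁅b 1, b 2⁆ = b 3 ∧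
      ⁅b 5, b 1⁆ = (1 - r) • b 6 ∧ ⁅b 4, b 2⁆ = (-r) • b 6 ∧
      ⁅b 3, b 0⁆ = b 6 ∧
      (∀ i j : Fin 7, i < j →
        (i, j) ∉ ({(0,1), (0,2), (1,2), (1,5), (2,4), (0,3)} : Set (Fin 7 × Fin 7)) →
        ⁅b i, b j⁆ = 0) ∧
      B (b 0) (b 0) = 1 ∧ B (b 1) (b 1) = 1 ∧ B (b 2) (b 2) = 1 ∧
      B (b 3) (b 3) = -a ∧ B (b 4) (b 4) = a * r ∧ B (b 5) (b 5) = a * (1 - r) ∧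
      B (b 6) (b 6) = a ^ 2 ∧
      (∀ i j : Fin 7, i < j → B (b i) (b j) = 0) := by
  have hm := hf.isEmpty_of_ne_of_ne h hg₀ hgpos hl hl' hll'
  obtain ⟨-, hκ, hΓ, -, hc₀, hb, hrest⟩ := hf.flat h hg₀ hgpos
  have hall := hf.eq_of_ne_of_ne h hg₀ hgpos hl hl' hll'
  have huniv : (Finset.univ : Finset (Fin d)) = {i₀, l, l'} := by
    ext i; simpa using hall i
  have hsum : ∀ F : Fin d → ℝ, ∑ i, F i = F i₀ + (F l + F l') := fun F => by
    rw [huniv, Finset.sum_insert (by simp [hl.symm, hl'.symm]), Finset.sum_pair hll']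
  have hsumH : ∀ F : Fin d → H, ∑ i, F i = F i₀ + (F l + F l') := fun F => by
    rw [huniv, Finset.sum_insert (by simp [hl.symm, hl'.symm]), Finset.sum_pair hll']
  have hT := hf.timelike_lie h hg₀ hgpos hl
  have hT' := hf.timelike_lie h hg₀ hgpos hl'
  have hl₁ : (Sum.inl l : Fin d ⊕ Fin m) ≠ .inl i₀ := by simpa using hl
  have hl₂ : (Sum.inl l' : Fin d ⊕ Fin m) ≠ .inl i₀ := by simpa using hl'
  obtain ⟨s, hs⟩ : ∃ s, B (u l) ⁅e (.inl i₀), e (.inl l')⁆ = s := ⟨_, rfl⟩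
  obtain ⟨γ, hγ⟩ : ∃ γ, g i₀ = -γ := ⟨-g i₀, (neg_neg _).symm⟩
  obtain ⟨g₁, hg₁⟩ : ∃ g₁, g l = g₁ := ⟨_, rfl⟩
  obtain ⟨g₂, hg₂⟩ : ∃ g₂, g l' = g₂ := ⟨_, rfl⟩
  have hγ0 : 0 < γ := by linarith
  have hg₁0 : 0 < g₁ := hg₁ ▸ hgpos l hl
  have hg₂0 : 0 < g₂ := hg₂ ▸ hgpos l' hl'
  have h12 : B (u i₀) ⁅e (.inl l), e (.inl l')⁆ = -s := by
    rw [hT.2 _ _ hl₁ hl₂, ← hs]; simp [hll']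
  have h01 : B (u l') ⁅e (.inl i₀), e (.inl l)⁆ = -s := by
    rw [← h12, hT'.2 _ _ hl₁ hl₂]; simp [hll'.symm]
  have hs2 : s ^ 2 = 1 := by
    have := hb l hl
    rw [Fintype.sum_sum_type, hsum] at this
    simpa [hT.1, hs] using this
  have hΓ' : 1 / g₁ + 1 / g₂ = 1 / γ := by
    rw [hsum, hγ, hg₁, hg₂, div_neg] at hΓ
    linarith
  have L01 : ⁅e (.inl i₀), e (.inl l)⁆ = (-(s / g₂)) • u l' := by
    rw [hf.lie_e_e, hsumH]; simp [hκ, hc₀, hT.1, h01, hg₂, neg_div]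
  have L02 : ⁅e (.inl i₀), e (.inl l')⁆ = (s / g₁) • u l := by
    rw [hf.lie_e_e, hsumH]; simp [hκ, hc₀, hT'.1, hs, hg₁]
  have L12 : ⁅e (.inl l), e (.inl l')⁆ = (s / γ) • u i₀ := by
    rw [hf.lie_e_e, hsumH]
    simp [hκ, hrest l hl _ _ hl₁ hl₂, hrest l' hl' _ _ hl₁ hl₂, h12, hγ]
  have L21 : ⁅e (.inl l'), e (.inl l)⁆ = (-(s / γ)) • u i₀ := by
    rw [← lie_skew, L12, neg_smul]
  have hs0 : s ≠ 0 := by rintro rfl; norm_num at hs2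
  have hr1 : 1 - γ / g₁ = γ / g₂ := by field_simp at hΓ' ⊢; linarith
  set v : Fin 7 → H := ![e (.inl i₀), e (.inl l'), e (.inl l), (-(s / γ)) • u i₀, (s / g₁) • u l,
    (-(s / g₂)) • u l', (-(s / γ)) • z] with hv
  set G : Fin 7 → ℝ := ![1, 1, 1, -(1 / γ), 1 / γ * (γ / g₁), 1 / γ * (1 - γ / g₁), (1 / γ) ^ 2]
    with hG
  have ho : ∀ i j, B (v i) (v j) = if i = j then G i else 0 := by
    intro i j
    fin_cases i <;> fin_cases j <;>
      simp [hv, hG, hf.e_e, hf.e_u, hf.u_e, hf.u_u, hf.u_center, hf.center_u, hf.center_center,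
        hf.e_center, hf.center_e, hl, hl', hll', hl.symm, hl'.symm, hll'.symm]
    · rw [hγ]; field_simp; rw [hs2]
    · rw [hg₁]; field_simp; exact hs2
    · rw [hg₂, hr1]; field_simp; exact hs2
    · field_simp; exact hs2
  have hG0 : ∀ i, G i ≠ 0 := by
    intro i
    fin_cases i <;> simp [hG, hγ0.ne', hg₁0.ne', hr1, hg₂0.ne']
  obtain ⟨b, hbv⟩ := exists_orthogonal_basis v G ho hG0 fun w hw => by
    have h0 := hw 0
    have h1 := hw 1
    have h2 := hw 2
    have h3 := hw 3
    have h4 := hw 4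
    have h5 := hw 5
    have h6 := hw 6
    simp [hv, hs0, hγ0.ne', hg₁0.ne', hg₂0.ne'] at h0 h1 h2 h3 h4 h5 h6
    refine hf.eq_zero_of_orthogonal h6 (fun i => ?_) ?_
    · rcases hall i with rfl | rfl | rfl <;> assumption
    · rintro (j | j)
      · rcases hall j with rfl | rfl | rfl <;> assumption
      · exact hm.elim j
  refine ⟨b, γ / g₁, 1 / γ, div_pos hγ0 hg₁0, ?_, one_div_pos.2 hγ0, ?_⟩
  · linarith [div_pos hγ0 hg₂0]
  simp only [hbv, ho]
  have hlie : ∀ i j : Fin 7, i < j →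
        (i, j) ∉ ({(0,1), (0,2), (1,2), (1,5), (2,4), (0,3)} : Set (Fin 7 × Fin 7)) →
        ⁅v i, v j⁆ = 0 := by
    intro i j hij hmem
    fin_cases i <;> fin_cases j <;> first
      | exact absurd hij (by decide)
      | (apply hmem.elim; simp; done)
      | simp [hv, hf.lie_e_u, hf.lie_u_u, h.lie_center, hl, hl', hll', hl.symm, hl'.symm,
          hll'.symm]
  refine ⟨L02, L01, L21, ?_, ?_, ?_, hlie, rfl, rfl, rfl, rfl, rfl, rfl, rfl,
    fun i j hij => if_neg hij.ne⟩
  · change ⁅(-(s / g₂)) • u l', e (.inl l')⁆ = (1 - γ / g₁) • (-(s / γ)) • z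
    rw [smul_lie, hf.lie_u_e, if_pos rfl, smul_smul, hr1]
    congr 1; field_simp
  · change ⁅(s / g₁) • u l, e (.inl l)⁆ = (-(γ / g₁)) • (-(s / γ)) • z
    rw [smul_lie, hf.lie_u_e, if_pos rfl, smul_smul]
    congr 1; field_simp
  · change ⁅(-(s / γ)) • u i₀, e (.inl i₀)⁆ = (-(s / γ)) • z
    rw [smul_lie, hf.lie_u_e, if_pos rfl]

theorem lie_inr (hf : IsAdaptedFrame B z g u e f) (h : ThreeStepEinstein B z lam)
    (hg₀ : g i₀ < 0) (hgpos : ∀ i, i ≠ i₀ → 0 < g i) {l : Fin d} (hl : l ≠ i₀)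
    (hall : ∀ i, i = i₀ ∨ i = l) (y : Fin m) (k : Fin d ⊕ Fin m) :
    ⁅e (.inr y), e k⁆ = B (u l) ⁅e (.inl i₀), e (.inr y)⁆ •
      ((if .inl l = k then (1 / g i₀) • u i₀ else 0) -
        if .inl i₀ = k then (1 / g l) • u l else 0) := by
  obtain ⟨-, hκ, -, -, hc₀, -, hrest⟩ := hf.flat h hg₀ hgpos
  have huniv : (Finset.univ : Finset (Fin d)) = {i₀, l} := by
    ext i; simpa using hall i
  rw [hf.lie_e_e, hκ, zero_smul, zero_add, huniv, Finset.sum_pair hl.symm]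
  by_cases hk : k = .inl i₀
  · subst hk
    rw [lie_e_swap, hc₀, lie_e_swap (u l)]
    simp only [if_true, Sum.inl.injEq, hl, if_false]
    module
  · rw [hrest l hl _ _ Sum.inr_ne_inl hk,
      (hf.timelike_lie h hg₀ hgpos hl).2 _ _ Sum.inr_ne_inl hk]
    simp only [reduceCtorEq, Ne.symm hk, if_false]
    split_ifs <;> module

theorem exists_unique_inr (hf : IsAdaptedFrame B z g u e f) (h : ThreeStepEinstein B z lam)
    (hg₀ : g i₀ < 0) (hgpos : ∀ i, i ≠ i₀ → 0 < g i) {l : Fin d} (hl : l ≠ i₀)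
    (hall : ∀ i, i = i₀ ∨ i = l) :
    ∃ y₀ : Fin m, (∀ y, y = y₀) ∧ B (u l) ⁅e (.inl i₀), e (.inr y₀)⁆ ^ 2 = 1 := by
  obtain ⟨-, hκ, -, -, hc₀, hb, hrest⟩ := hf.flat h hg₀ hgpos
  have huniv : (Finset.univ : Finset (Fin d)) = {i₀, l} := by
    ext i; simpa using hall i
  have hsum := hb l hl
  rw [Fintype.sum_sum_type, huniv, Finset.sum_pair hl.symm,
    (hf.timelike_lie h hg₀ hgpos hl).1, lie_self, map_zero, zero_pow two_ne_zero, add_zero,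
    zero_add] at hsum
  obtain ⟨y₀, -, hy₀⟩ := Finset.exists_ne_zero_of_sum_ne_zero (hsum.trans_ne one_ne_zero)
  have huniq : ∀ y, y = y₀ := by
    by_contra! hne
    obtain ⟨y, hy⟩ := hne
    set s : Fin m → ℝ := fun y => B (u l) ⁅e (.inl i₀), e (.inr y)⁆ with hs
    have h0 : s y₀ • e (.inr y) - s y • e (.inr y₀) = 0 := by
      refine hf.eq_zero_of_commute h (by simp [hf.center_e])
        (fun i => by simp [hf.lie_e_u]) fun k => ?_
      rw [sub_lie, smul_lie, smul_lie, hf.lie_inr h hg₀ hgpos hl hall y,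
        hf.lie_inr h hg₀ hgpos hl hall y₀]
      module
    have h1 := congrArg (B (e (.inr y))) h0
    simp [hf.e_e, hy] at h1
    have h2 : B (u l) ⁅e (.inl i₀), e (.inr y₀)⁆ = 0 := h1
    exact hy₀ (by rw [h2, zero_pow two_ne_zero])
  refine ⟨y₀, huniq, ?_⟩
  rwa [Fintype.sum_eq_single y₀ fun y hy => absurd (huniq y) hy] at hsum

theorem forall_bracket_six {P : Fin 6 → Fin 6 → Prop} (h03 : P 0 3) (h04 : P 0 4) (h05 : P 0 5)
    (h12 : P 1 2) (h14 : P 1 4) (h15 : P 1 5) (h23 : P 2 3) (h25 : P 2 5) (h34 : P 3 4)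
    (h35 : P 3 5) (h45 : P 4 5) (i j : Fin 6) (hij : i < j)
    (hmem : (i, j) ∉ ({(0,1), (0,2), (1,3), (2,4)} : Set (Fin 6 × Fin 6))) : P i j := by
  fin_cases i <;> fin_cases j <;> first | assumption | simp at hij hmem

theorem ne_swap_of_notMem_six (i j : Fin 6) (hij : i ≤ j)
    (hmem : (i, j) ∉ ({(0,0), (1,1), (2,2), (5,5), (3,4)} : Set (Fin 6 × Fin 6))) :
    Equiv.swap 3 4 i ≠ j := by
  simp only [Set.mem_insert_iff, Set.mem_singleton_iff, Prod.mk.injEq] at hmem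
  revert i j
  decide

theorem eq_vec_swap {α : Type*} (v : Fin 6 → α) (i : Fin 6) :
    v i = ![v 0, v 1, v 2, v 4, v 3, v 5] (Equiv.swap 3 4 i) := by
  have hs : ⇑(Equiv.swap (3 : Fin 6) 4) = ![0, 1, 2, 4, 3, 5] := by decide
  rw [hs]
  fin_cases i <;> rfl

theorem exists_basis_six (hf : IsAdaptedFrame B z g u e f) (h : ThreeStepEinstein B z lam)
    (hg₀ : g i₀ < 0) (hgpos : ∀ i, i ≠ i₀ → 0 < g i) {l : Fin d} (hl : l ≠ i₀)
    (hall : ∀ i, i = i₀ ∨ i = l) :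
    ∃ (b : Basis (Fin 6) ℝ H) (α : ℝ), α ≠ 0 ∧
      ⁅b 0, b 1⁆ = b 3 ∧ ⁅b 0, b 2⁆ = b 4 ∧
      ⁅b 1, b 3⁆ = b 5 ∧ ⁅b 2, b 4⁆ = - b 5 ∧
      (∀ i j : Fin 6, i < j →
        (i, j) ∉ ({(0,1), (0,2), (1,3), (2,4)} : Set (Fin 6 × Fin 6)) →
        ⁅b i, b j⁆ = 0) ∧
      B (b 0) (b 0) = 1 ∧ B (b 1) (b 1) = 2 ∧ B (b 2) (b 2) = 2 ∧
      B (b 5) (b 5) = 4 * α ^ 4 ∧ B (b 3) (b 4) = -2 * α ^ 2 ∧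
      (∀ i j : Fin 6, i ≤ j →
        (i, j) ∉ ({(0,0), (1,1), (2,2), (5,5), (3,4)} : Set (Fin 6 × Fin 6)) →
        B (b i) (b j) = 0) := by
  obtain ⟨-, hκ, hΓ, -, hc₀, hb, hrest⟩ := hf.flat h hg₀ hgpos
  have hT := hf.timelike_lie h hg₀ hgpos hl
  have huniv : (Finset.univ : Finset (Fin d)) = {i₀, l} := by
    ext i; simpa using hall i
  obtain ⟨y, hy, hs2⟩ := hf.exists_unique_inr h hg₀ hgpos hl hall
  have hlie := hf.lie_inr h hg₀ hgpos hl hall y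
  generalize B (u l) ⁅e (.inl i₀), e (.inr y)⁆ = s at hs2 hlie
  obtain ⟨γ, hγ⟩ : ∃ γ, g l = γ := ⟨_, rfl⟩
  have hγ0 : 0 < γ := hγ ▸ hgpos l hl
  have hγ' : g i₀ = -γ := by
    rw [huniv, Finset.sum_pair hl.symm, hγ] at hΓ
    have := hg₀.ne
    field_simp at hΓ
    linarith
  have L01 : ⁅e (.inl i₀), e (.inl l)⁆ = 0 := by
    rw [hf.lie_e_e, huniv, Finset.sum_pair hl.symm]; simp [hκ, hc₀, hT.1]
  have L10 : ⁅e (.inl l), e (.inl i₀)⁆ = 0 := by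
    rw [← lie_skew, L01, neg_zero]
  have Ly0 : ⁅e (.inr y), e (.inl i₀)⁆ = (-(s / γ)) • u l := by
    rw [hlie]; simp [hl, hγ, smul_smul]; rfl
  have Ly1 : ⁅e (.inr y), e (.inl l)⁆ = (-(s / γ)) • u i₀ := by
    rw [hlie]; simp [hl.symm, hγ', smul_smul]; rfl
  have hs0 : s ≠ 0 := by rintro rfl; norm_num at hs2
  set v : Fin 6 → H := ![s • e (.inr y), e (.inl i₀) + e (.inl l), e (.inl l) - e (.inl i₀),
    (-(1 / γ)) • (u i₀ + u l), (1 / γ) • (u l - u i₀), (2 / γ) • z] with hv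
  set w : Fin 6 → H := ![v 0, v 1, v 2, v 4, v 3, v 5] with hw
  set G : Fin 6 → ℝ := ![1, 2, 2, -2 / γ, -2 / γ, 4 / γ ^ 2] with hG
  have ho : ∀ i j, B (w i) (v j) = if i = j then G i else 0 := by
    intro i j
    fin_cases i <;> fin_cases j <;>
      simp [hv, hw, hG, hf.e_e, hf.e_u, hf.u_e, hf.u_u, hf.u_center, hf.center_u,
        hf.center_center, hf.e_center, hf.center_e, hl, hl.symm, hγ, hγ']
    · linarith
    · norm_num
    · norm_num
    · field_simp; norm_num
    · field_simp; norm_num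
    · field_simp; norm_num
  have hG0 : ∀ i, G i ≠ 0 := by
    intro i
    fin_cases i <;> simp [hG, hγ0.ne']
  obtain ⟨b, hbv⟩ := exists_basis_of_biorthogonal w v G ho hG0 fun x hx => by
    have h0 := hx 0
    have h1 := hx 1
    have h2 := hx 2
    have h3 := hx 3
    have h4 := hx 4
    have h5 := hx 5
    simp [hv, hw, hs0, hγ0.ne'] at h0 h1 h2 h3 h4 h5
    refine hf.eq_zero_of_orthogonal h5 (fun i => ?_) ?_
    · have h4' : B (u i₀) x + B (u l) x = 0 := by
        have := hγ0.ne'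
        field_simp at h4
        linarith
      rcases hall i with rfl | rfl <;> linarith
    · rintro (j | j)
      · rcases hall j with rfl | rfl <;> linarith
      · rw [hy j, h0]
  refine ⟨b, 1 / √γ, by positivity, ?_⟩
  simp only [hbv]
  have hα2 : (1 / √γ) ^ 2 = 1 / γ := by rw [div_pow, Real.sq_sqrt hγ0.le, one_pow]
  have hα4 : (1 / √γ) ^ 4 = 1 / γ ^ 2 := by
    rw [show (1 / √γ) ^ 4 = ((1 / √γ) ^ 2) ^ 2 by ring, hα2]; ring
  rw [hα2, hα4]
  refine ⟨?_, ?_, ?_, ?_, ?_, ho 0 0, ho 1 1, ho 2 2, ?_, ?_, ?_⟩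
  · change ⁅s • e (.inr y), e (.inl i₀) + e (.inl l)⁆ = (-(1 / γ)) • (u i₀ + u l)
    rw [smul_lie, lie_add, Ly0, Ly1]
    match_scalars <;> field_simp <;> first | linear_combination hs2 | linear_combination -hs2
  · change ⁅s • e (.inr y), e (.inl l) - e (.inl i₀)⁆ = (1 / γ) • (u l - u i₀)
    rw [smul_lie, lie_sub, Ly0, Ly1]
    match_scalars <;> field_simp <;> first | linear_combination hs2 | linear_combination -hs2
  · change ⁅e (.inl i₀) + e (.inl l), (-(1 / γ)) • (u i₀ + u l)⁆ = (2 / γ) • z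
    simp only [lie_smul, lie_add, add_lie, hf.lie_e_u]
    simp [hl, hl.symm]
    module
  · change ⁅e (.inl l) - e (.inl i₀), (1 / γ) • (u l - u i₀)⁆ = -((2 / γ) • z)
    simp only [lie_smul, lie_sub, sub_lie, hf.lie_e_u]
    simp [hl, hl.symm]
    module
  · refine forall_bracket_six ?_ ?_ ?_ ?_ ?_ ?_ ?_ ?_ ?_ ?_ ?_
    · change ⁅s • e (.inr y), (-(1 / γ)) • (u i₀ + u l)⁆ = 0
      simp [hf.lie_e_u]
    · change ⁅s • e (.inr y), (1 / γ) • (u l - u i₀)⁆ = 0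
      simp [hf.lie_e_u]
    · change ⁅s • e (.inr y), (2 / γ) • z⁆ = 0
      simp [h.lie_center]
    · change ⁅e (.inl i₀) + e (.inl l), e (.inl l) - e (.inl i₀)⁆ = 0
      simp [L01, L10]
    · change ⁅e (.inl i₀) + e (.inl l), (1 / γ) • (u l - u i₀)⁆ = 0
      simp [hf.lie_e_u, hl, hl.symm]
    · change ⁅e (.inl i₀) + e (.inl l), (2 / γ) • z⁆ = 0
      simp [h.lie_center]
    · change ⁅e (.inl l) - e (.inl i₀), (-(1 / γ)) • (u i₀ + u l)⁆ = 0
      simp [hf.lie_e_u, hl, hl.symm]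
    · change ⁅e (.inl l) - e (.inl i₀), (2 / γ) • z⁆ = 0
      simp [h.lie_center]
    · change ⁅(-(1 / γ)) • (u i₀ + u l), (1 / γ) • (u l - u i₀)⁆ = 0
      simp [hf.lie_u_u]
    · change ⁅(-(1 / γ)) • (u i₀ + u l), (2 / γ) • z⁆ = 0
      simp [h.lie_center]
    · change ⁅(1 / γ) • (u l - u i₀), (2 / γ) • z⁆ = 0
      simp [h.lie_center]
  · exact (ho 5 5).trans (by simp [hG]; ring)
  · exact (ho 4 4).trans (by simp [hG]; ring)
  · intro i j hij hmem
    rw [eq_vec_swap v i, ho, if_neg (ne_swap_of_notMem_six i j hij hmem)]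
end IsAdaptedFrame

theorem IsAdaptedFrame.exists_basis_six_or_seven {H : Type*} [LieRing H] [LieAlgebra ℝ H]
    {B : H →ₗ[ℝ] H →ₗ[ℝ] ℝ} {z : H} {lam : ℝ} {d m : ℕ} {g : Fin d → ℝ} {u : Fin d → H}
    {e : Fin d ⊕ Fin m → H} {f : Basis ((Unit ⊕ Fin d) ⊕ (Fin d ⊕ Fin m)) ℝ H}
    (hf : IsAdaptedFrame B z g u e f) (h : ThreeStepEinstein B z lam) :
    lam = 0 ∧
      ((∃ (b : Basis (Fin 6) ℝ H) (α : ℝ), α ≠ 0 ∧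
          ⁅b 0, b 1⁆ = b 3 ∧ ⁅b 0, b 2⁆ = b 4 ∧
          ⁅b 1, b 3⁆ = b 5 ∧ ⁅b 2, b 4⁆ = - b 5 ∧
          (∀ i j : Fin 6, i < j →
            (i, j) ∉ ({(0,1), (0,2), (1,3), (2,4)} : Set (Fin 6 × Fin 6)) →
            ⁅b i, b j⁆ = 0) ∧
          B (b 0) (b 0) = 1 ∧ B (b 1) (b 1) = 2 ∧ B (b 2) (b 2) = 2 ∧
          B (b 5) (b 5) = 4 * α ^ 4 ∧ B (b 3) (b 4) = -2 * α ^ 2 ∧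
          (∀ i j : Fin 6, i ≤ j →
            (i, j) ∉ ({(0,0), (1,1), (2,2), (5,5), (3,4)} : Set (Fin 6 × Fin 6)) →
            B (b i) (b j) = 0)) ∨
        (∃ (b : Basis (Fin 7) ℝ H) (r a : ℝ), 0 < r ∧ r < 1 ∧ 0 < a ∧
          ⁅b 0, b 1⁆ = b 4 ∧ ⁅b 0, b 2⁆ = b 5 ∧ ⁅b 1, b 2⁆ = b 3 ∧
          ⁅b 5, b 1⁆ = (1 - r) • b 6 ∧ ⁅b 4, b 2⁆ = (-r) • b 6 ∧
          ⁅b 3, b 0⁆ = b 6 ∧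
          (∀ i j : Fin 7, i < j →
            (i, j) ∉ ({(0,1), (0,2), (1,2), (1,5), (2,4), (0,3)} : Set (Fin 7 × Fin 7)) →
            ⁅b i, b j⁆ = 0) ∧
          B (b 0) (b 0) = 1 ∧ B (b 1) (b 1) = 1 ∧ B (b 2) (b 2) = 1 ∧
          B (b 3) (b 3) = -a ∧ B (b 4) (b 4) = a * r ∧ B (b 5) (b 5) = a * (1 - r) ∧
          B (b 6) (b 6) = a ^ 2 ∧
          (∀ i j : Fin 7, i < j → B (b i) (b j) = 0))) := by
  obtain ⟨i₀, hg₀, hgpos⟩ := hf.exists_neg h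
  obtain ⟨l, hl⟩ := hf.exists_ne h hg₀ hgpos
  refine ⟨(hf.flat h hg₀ hgpos).1, ?_⟩
  by_cases hl' : ∃ l', l' ≠ i₀ ∧ l' ≠ l
  · obtain ⟨l', hl', hll'⟩ := hl'
    exact .inr (hf.exists_basis_seven h hg₀ hgpos hl hl' hll'.symm)
  · push Not at hl'
    exact .inl (hf.exists_basis_six h hg₀ hgpos hl fun i => or_iff_not_imp_left.2 (hl' i))

theorem IsLorentzianForm.pos_of_orthogonal {V : Type*} [AddCommGroup V] [Module ℝ V]
    {B : V →ₗ[ℝ] V →ₗ[ℝ] ℝ} (hB : IsLorentzianForm B) (hsymm : ∀ u v, B u v = B v u) (t v : V)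
    (ht : B t t < 0) (htv : B t v = 0) (hv : v ≠ 0) : 0 < B v v := by
  obtain ⟨n, b, hort, hneg, hpos⟩ := hB
  set g : Fin (n + 1) → ℝ := Fin.cons (-1) fun _ => 1
  have hg0 : ∀ i, g i ≠ 0 := by
    refine Fin.cases ?_ fun i => ?_ <;> simp [g]
  have he : ∀ i j, B (b i) (b j) = if i = j then g i else 0 := by
    intro i j
    split_ifs with hij
    · subst hij
      refine Fin.cases ?_ (fun i => ?_) i
      · simpa [g] using hneg
      · simpa [g] using hpos i.succ (Fin.succ_ne_zero i)
    · exact hort i j hij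
  have hsum : ∀ x y, B x y = -(B x (b 0) * B y (b 0)) +
      ∑ i : Fin n, B x (b i.succ) * B y (b i.succ) := fun x y => by
    rw [parseval he hg0 hsymm x y, Fin.sum_univ_succ]
    simp [g, div_neg]
  have hcs := Finset.sum_mul_sq_le_sq_mul_sq Finset.univ
    (fun i : Fin n => B t (b i.succ)) (fun i : Fin n => B v (b i.succ))
  rw [hsum] at ht htv ⊢
  simp only [← pow_two] at ht ⊢
  have hT : 0 ≤ ∑ i : Fin n, B t (b i.succ) ^ 2 := Finset.sum_nonneg fun _ _ => sq_nonneg _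
  have hV : 0 ≤ ∑ i : Fin n, B v (b i.succ) ^ 2 := Finset.sum_nonneg fun _ _ => sq_nonneg _
  by_contra! hle
  have hv0 : B v (b 0) ^ 2 ≤ 0 := by
    rw [show ∑ i : Fin n, B t (b i.succ) * B v (b i.succ) = B t (b 0) * B v (b 0) by linarith]
      at hcs
    nlinarith [mul_nonneg hT (sub_nonneg.2 (show ∑ i : Fin n, B v (b i.succ) ^ 2 ≤
      B v (b 0) ^ 2 by linarith)), sq_nonneg (B v (b 0))]
  have hV0 : ∑ i : Fin n, B v (b i.succ) ^ 2 = 0 := by linarith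
  rw [Finset.sum_eq_zero_iff_of_nonneg fun _ _ => sq_nonneg _] at hV0
  refine hv (b.ext_elem fun i => ?_)
  rw [repr_eq_div he hg0, hsymm]
  refine Fin.cases ?_ (fun i => ?_) i
  · simp [pow_eq_zero_iff two_ne_zero |>.1 (hv0.antisymm (sq_nonneg _))]
  · simp [pow_eq_zero_iff two_ne_zero |>.1 (hV0 i (Finset.mem_univ _))]

section LowerCentralSeries
variable {H : Type*} [LieRing H] [LieAlgebra ℝ H]

theorem lie_lie_lie_eq_zero_of_lowerCentralSeries
    (h : LieModule.lowerCentralSeries ℝ H H 3 = ⊥) (a b c d : H) : ⁅a, ⁅b, ⁅c, d⁆⁆⁆ = 0 := by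
  have hstep : ∀ (k : ℕ) (x y : H), y ∈ LieModule.lowerCentralSeries ℝ H H k →
      ⁅x, y⁆ ∈ LieModule.lowerCentralSeries ℝ H H (k + 1) := fun k x y hy => by
    rw [LieModule.lowerCentralSeries_succ]
    exact LieSubmodule.lie_mem_lie (LieSubmodule.mem_top x) hy
  have := hstep 2 a _ (hstep 1 b _ (hstep 0 c d (by simp)))
  rwa [h, LieSubmodule.mem_bot] at this

theorem exists_lie_lie_ne_zero_of_lowerCentralSeries
    (h : LieModule.lowerCentralSeries ℝ H H 2 ≠ ⊥) : ∃ a b c : H, ⁅a, ⁅b, c⁆⁆ ≠ 0 := by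
  by_contra! hzero
  refine h ?_
  rw [LieModule.lowerCentralSeries_succ, LieSubmodule.lie_eq_bot_iff]
  intro x _ m hm
  rw [LieModule.lowerCentralSeries_succ, ← LieSubmodule.mem_toSubmodule,
    LieSubmodule.lieIdeal_oper_eq_linear_span] at hm
  induction hm using Submodule.span_induction with
  | mem y hy =>
    obtain ⟨p, q, rfl⟩ := hy
    exact hzero _ _ _
  | zero => exact lie_zero x
  | add y y' _ _ hy hy' => rw [lie_add, hy, hy', add_zero]
  | smul c y _ hy => rw [lie_smul, hy, smul_zero]

theorem exists_unit_center {B : H →ₗ[ℝ] H →ₗ[ℝ] ℝ}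
    (hZdim : Module.finrank ℝ (LieAlgebra.center ℝ H).toSubmodule = 1)
    (hZnd : ∀ z ∈ LieAlgebra.center ℝ H,
      (∀ w ∈ LieAlgebra.center ℝ H, B z w = 0) → z = 0) :
    ∃ z : H, (∀ v : H, ⁅v, z⁆ = 0) ∧ (∀ v : H, (∀ w : H, ⁅w, v⁆ = 0) → ∃ c : ℝ, v = c • z) ∧
      (B z z = 1 ∨ B z z = -1) := by
  obtain ⟨⟨x, hx⟩, hx0, hspan⟩ := finrank_eq_one_iff'.1 hZdim
  have hx' : ∀ v : H, ⁅v, x⁆ = 0 := (LieModule.mem_maxTrivSubmodule ℝ H H x).1 hx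
  have hsp : ∀ v : H, (∀ w : H, ⁅w, v⁆ = 0) → ∃ c : ℝ, c • x = v := fun v hv => by
    obtain ⟨c, hc⟩ := hspan ⟨v, (LieModule.mem_maxTrivSubmodule ℝ H H v).2 hv⟩
    exact ⟨c, congrArg Subtype.val hc⟩
  have hxx : B x x ≠ 0 := fun h0 => hx0 <| Subtype.ext <| hZnd x hx fun w hw => by
    obtain ⟨c, rfl⟩ := hsp w ((LieModule.mem_maxTrivSubmodule ℝ H H w).1 hw)
    rw [map_smul, h0, smul_zero]
  have habs : 0 < |B x x| := abs_pos.2 hxx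
  have hs : √|B x x| ≠ 0 := (Real.sqrt_pos.2 habs).ne'
  refine ⟨(√|B x x|)⁻¹ • x, fun v => by rw [lie_smul, hx', smul_zero], fun v hv => ?_, ?_⟩
  · obtain ⟨c, rfl⟩ := hsp v hv
    exact ⟨c * √|B x x|, by rw [smul_smul, mul_assoc, mul_inv_cancel₀ hs, mul_one]⟩
  · have hval : B ((√|B x x|)⁻¹ • x) ((√|B x x|)⁻¹ • x) = B x x / |B x x| := by
      simp only [map_smul, LinearMap.smul_apply, smul_eq_mul]
      rw [← mul_assoc, ← mul_inv, Real.mul_self_sqrt habs.le, inv_mul_eq_div]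
    rw [hval]
    rcases abs_choice (B x x) with h | h <;> rw [h]
    · exact .inl (div_self hxx)
    · exact .inr (by rw [div_neg, div_self hxx])

end LowerCentralSeries

/-- **Main Theorem.**  Let `h` be a 3-step nilpotent real Lie algebra with
`dim Z(h) = 1` and `⟨·,·⟩` a Lorentzian metric on `h` with `Z(h)` nondegenerate.  Then
`⟨·,·⟩` is Einstein iff `h` is Ricci-flat and either (i) `dim h = 6`, `h ≅ L_{6,19}(−1)`
(basis `f₁,…,f₆ = b 0,…,b 5`) with the metric
`f₁*⊗f₁* + 2f₂*⊗f₂* + 2f₃*⊗f₃* + 4α⁴f₆*⊗f₆* − 2α² f₄*⊙f₅*`, or (ii) `dim h = 7`,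
`h ≅ 147E` (basis `f₁,…,f₇ = b 0,…,b 6`) with the metric
`f₁*² + f₂*² + f₃*² − a f₄*² + ar f₅*² + a(1−r) f₆*² + a² f₇*²`, `0 < r < 1`, `a > 0`. -/
theorem statement14
    {H : Type*} [LieRing H] [LieAlgebra ℝ H] [Module.Finite ℝ H]
    (B : H →ₗ[ℝ] H →ₗ[ℝ] ℝ)
    (hsymm : ∀ u v : H, B u v = B v u)
    (hnd : ∀ u : H, (∀ v : H, B u v = 0) → u = 0)
    (hLor : IsLorentzianForm B)
    -- `h` is 3-step nilpotent: `C⁴(h) = 0` and `C³(h) ≠ 0`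
    (h3step : LieModule.lowerCentralSeries ℝ H H 3 = ⊥ ∧
      LieModule.lowerCentralSeries ℝ H H 2 ≠ ⊥)
    -- `dim Z(h) = 1`
    (hZdim : Module.finrank ℝ (LieAlgebra.center ℝ H).toSubmodule = 1)
    -- `Z(h)` is nondegenerate
    (hZnd : ∀ z ∈ LieAlgebra.center ℝ H,
      (∀ w ∈ LieAlgebra.center ℝ H, B z w = 0) → z = 0)
    -- `adStar u` is the adjoint of `ad u` with respect to `B`
    (adStar : H → Module.End ℝ H)
    (hadStar : ∀ u v w : H, B (adStar u v) w = B v ⁅u, w⁆)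
    -- `Jm u` is the skew-symmetric endomorphism `J_u(v) = ad_v*(u)`
    (Jm : H → Module.End ℝ H)
    (hJm : ∀ u v w : H, B (Jm u v) w = B u ⁅v, w⁆) :
    -- `⟨·,·⟩` is Einstein ...
    (∃ lam : ℝ, ∀ u v : H,
      -(1/2) * LinearMap.trace ℝ H ((LieAlgebra.ad ℝ H u : Module.End ℝ H) ∘ₗ adStar v)
        - (1/4) * LinearMap.trace ℝ H (Jm u ∘ₗ Jm v) = lam * B u v)
    ↔
    -- ... iff `h` is Ricci-flat ...
    ((∀ u v : H,
      -(1/2) * LinearMap.trace ℝ H ((LieAlgebra.ad ℝ H u : Module.End ℝ H) ∘ₗ adStar v)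
        - (1/4) * LinearMap.trace ℝ H (Jm u ∘ₗ Jm v) = 0) ∧
    -- ... and has one of the following two forms:
      -- (i) `dim h = 6`, `h ≅ L_{6,19}(−1)` with metric \eqref{6dimmetric1}
      ((∃ (b : Basis (Fin 6) ℝ H) (α : ℝ), α ≠ 0 ∧
          ⁅b 0, b 1⁆ = b 3 ∧ ⁅b 0, b 2⁆ = b 4 ∧
          ⁅b 1, b 3⁆ = b 5 ∧ ⁅b 2, b 4⁆ = - b 5 ∧
          (∀ i j : Fin 6, i < j →
            (i, j) ∉ ({(0,1), (0,2), (1,3), (2,4)} : Set (Fin 6 × Fin 6)) →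
            ⁅b i, b j⁆ = 0) ∧
          B (b 0) (b 0) = 1 ∧ B (b 1) (b 1) = 2 ∧ B (b 2) (b 2) = 2 ∧
          B (b 5) (b 5) = 4 * α ^ 4 ∧ B (b 3) (b 4) = -2 * α ^ 2 ∧
          (∀ i j : Fin 6, i ≤ j →
            (i, j) ∉ ({(0,0), (1,1), (2,2), (5,5), (3,4)} : Set (Fin 6 × Fin 6)) →
            B (b i) (b j) = 0)) ∨
      -- (ii) `dim h = 7`, `h ≅ 147E` with metric \eqref{structmetric7}
        (∃ (b : Basis (Fin 7) ℝ H) (r a : ℝ), 0 < r ∧ r < 1 ∧ 0 < a ∧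
          ⁅b 0, b 1⁆ = b 4 ∧ ⁅b 0, b 2⁆ = b 5 ∧ ⁅b 1, b 2⁆ = b 3 ∧
          ⁅b 5, b 1⁆ = (1 - r) • b 6 ∧ ⁅b 4, b 2⁆ = (-r) • b 6 ∧
          ⁅b 3, b 0⁆ = b 6 ∧
          (∀ i j : Fin 7, i < j →
            (i, j) ∉ ({(0,1), (0,2), (1,2), (1,5), (2,4), (0,3)} : Set (Fin 7 × Fin 7)) →
            ⁅b i, b j⁆ = 0) ∧
          B (b 0) (b 0) = 1 ∧ B (b 1) (b 1) = 1 ∧ B (b 2) (b 2) = 1 ∧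
          B (b 3) (b 3) = -a ∧ B (b 4) (b 4) = a * r ∧ B (b 5) (b 5) = a * (1 - r) ∧
          B (b 6) (b 6) = a ^ 2 ∧
          (∀ i j : Fin 7, i < j → B (b i) (b j) = 0)))) := by
  refine ⟨?_, fun h => ⟨0, fun u v => by rw [h.1 u v, zero_mul]⟩⟩
  rintro ⟨lam, hlam⟩
  obtain ⟨z, hzc, hzspan, hzz⟩ := exists_unit_center hZdim hZnd
  have h : ThreeStepEinstein B z lam :=
    { symm := hsymm
      pos_of_orthogonal := hLor.pos_of_orthogonal hsymm
      exists_timelike := by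
        obtain ⟨n, b, -, hneg, -⟩ := hLor
        exact ⟨b 0, by rw [hneg]; norm_num⟩
      lie_lie_lie := lie_lie_lie_eq_zero_of_lowerCentralSeries h3step.1
      exists_lie_lie_ne_zero := exists_lie_lie_ne_zero_of_lowerCentralSeries h3step.2
      lie_center := hzc
      eq_smul_of_central := hzspan
      einstein := fun e g he hg u v =>
        (ricci_eq_ricciSum hsymm adStar hadStar Jm hJm he hg u v).symm.trans (hlam u v) }
  obtain ⟨d, m, g, u, e, f, hf⟩ := h.exists_adaptedFrame
    (hzz.resolve_right h.center_not_timelike) hnd (Jm z) (hJm z)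
  obtain ⟨rfl, hcases⟩ := hf.exists_basis_six_or_seven h
  exact ⟨fun u v => by rw [hlam, zero_mul], hcases⟩
end
end
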